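/- Let d ≥ 1 and let (q,r) be an admissible pair. There exists a constant C = C(d,q,r) > 0 such that for every Schwartz function φ : ℝ^d → ℂ, ( ∫_ℝ ‖e^{itΔ}φ‖_{L^r(ℝ^d)}^q dt )^{1/q} ≤ C ‖φ‖_{L²(ℝ^d)} (with the essential supremum in t when q = ∞). -/

import Mathlib

open MeasureTheory Complex
open scoped ENNReal NNReal FourierTransform

noncomputable section

/-- The free Schrödinger propagator `e^{itΔ}`:
`(e^{itΔ}φ)(x) = (4πit)^{-d/2} ∫ e^{i|x-y|²/(4t)} φ(y) dy`. -/
def schrod (d : ℕ) (t : ℝ) (φ : EuclideanSpace ℝ (Fin d) → ℂ)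
    (x : EuclideanSpace ℝ (Fin d)) : ℂ :=
  (((4 * Real.pi * t : ℝ) : ℂ) * Complex.I) ^ (-(d : ℂ) / 2) *
    ∫ y : EuclideanSpace ℝ (Fin d),
      Complex.exp (Complex.I * ((‖x - y‖ : ℝ) : ℂ) ^ 2 / ((4 * t : ℝ) : ℂ)) * φ y

/-- `(q,r)` is a Schrödinger-admissible pair in dimension `d`:
`2 ≤ q, r ≤ ∞`, `2/q + d/r = d/2`, and `(d,q,r) ≠ (2,2,∞)`. -/
def IsAdmissible (d : ℕ) (q r : ℝ≥0∞) : Prop :=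
  2 ≤ q ∧ 2 ≤ r ∧ 2 / q + (d : ℝ≥0∞) / r = (d : ℝ≥0∞) / 2 ∧ ¬(d = 2 ∧ q = 2 ∧ r = ∞)

/-- The mixed (time) norm `( ∫_ℝ g(t)^q dt )^{1/q}`, with the essential supremum when
`q = ∞`. -/
def mixedLNorm (q : ℝ≥0∞) (g : ℝ → ℝ≥0∞) : ℝ≥0∞ :=
  if q = ∞ then essSup g (volume : Measure ℝ)
  else (∫⁻ t : ℝ, g t ^ q.toReal) ^ (1 / q.toReal)

lemma two_ne_top' : (2:ℝ≥0∞) ≠ ⊤ := by norm_num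

lemma two_rpow_add (a b : ℝ) : (2:ℝ≥0∞)^(a+b) = 2^a * 2^b :=
  ENNReal.rpow_add _ _ (by norm_num) (by norm_num)

lemma two_rpow_ne_top (a : ℝ) : (2:ℝ≥0∞)^a ≠ ⊤ := by simp
lemma two_rpow_ne_zero (a : ℝ) : (2:ℝ≥0∞)^a ≠ 0 := by simp

lemma two_rpow_mono {a b : ℝ} (h : a ≤ b) : (2:ℝ≥0∞)^a ≤ 2^b :=
  ENNReal.rpow_le_rpow_of_exponent_le (by norm_num) h

def geoSum (c : ℝ) : ℝ≥0∞ := ∑' i : ℤ, (2:ℝ≥0∞)^(-(c*|(i:ℝ)|))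

lemma geoSum_ne_top {c : ℝ} (hc : 0 < c) : geoSum c ≠ ⊤ := by
  have h1 : ∀ i : ℤ, (2:ℝ≥0∞)^(-(c*|(i:ℝ)|)) = ENNReal.ofReal ((2:ℝ)^(-(c*|(i:ℝ)|))) := by
    intro i
    rw [← ENNReal.ofReal_rpow_of_pos (by norm_num)]
    simp
  unfold geoSum
  simp_rw [h1]
  apply Summable.tsum_ofReal_ne_top
  have h2 : Summable (fun n : ℕ => ((2:ℝ)^(-c))^n) := by
    apply summable_geometric_of_lt_one (by positivity)
    exact Real.rpow_lt_one_of_one_lt_of_neg (by norm_num) (by linarith)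
  apply Summable.of_nat_of_neg
  · refine h2.congr (fun n => ?_)
    rw [← Real.rpow_natCast, ← Real.rpow_mul (by norm_num)]
    simp
  · refine h2.congr (fun n => ?_)
    rw [← Real.rpow_natCast, ← Real.rpow_mul (by norm_num)]
    simp

lemma mul_le_sq_add_sq (a b : ℝ≥0∞) : a * b ≤ a^2 + b^2 := by
  rcases le_total a b with h | h
  · calc a * b ≤ b * b := by gcongr
      _ = b^2 := (sq b).symm
      _ ≤ _ := le_add_self
  · calc a * b ≤ a * a := by gcongr
      _ = a^2 := (sq a).symm
      _ ≤ _ := le_self_add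

lemma schur_hankel (K x y : ℤ → ℝ≥0∞) :
    ∑' j, ∑' l, K (j + l) * (x j + y l) = (∑' i, K i) * (∑' j, x j + ∑' l, y l) := by
  simp_rw [mul_add, ENNReal.tsum_add]
  congr 1
  · rw [← ENNReal.tsum_mul_left]
    congr 1; ext j
    rw [ENNReal.tsum_mul_right]
    congr 1
    exact (Equiv.addLeft j).tsum_eq K
  · rw [ENNReal.tsum_comm, ← ENNReal.tsum_mul_left]
    congr 1; ext j
    rw [ENNReal.tsum_mul_right]
    congr 1
    exact (Equiv.addRight j).tsum_eq K

lemma schur_diff (K x y : ℤ → ℝ≥0∞) :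
    ∑' j, ∑' l, K (j - l) * (x j + y l) = (∑' i, K i) * (∑' j, x j + ∑' l, y l) := by
  simp_rw [mul_add, ENNReal.tsum_add]
  congr 1
  · rw [← ENNReal.tsum_mul_left]
    congr 1; ext j
    rw [ENNReal.tsum_mul_right]
    congr 1
    exact (Equiv.subLeft j).tsum_eq K
  · rw [ENNReal.tsum_comm, ← ENNReal.tsum_mul_left]
    congr 1; ext j
    rw [ENNReal.tsum_mul_right]
    congr 1
    exact (Equiv.subRight j).tsum_eq K

/-- level sets -/
def lev {X : Type*} (N : ℝ≥0∞) (p : ℝ) (f : X → ℝ≥0∞) (j : ℤ) : Set X :=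
  {x | 2^(j:ℝ) * N^p < f x^p ∧ f x^p ≤ 2^((j:ℝ)+1) * N^p}

lemma lev_unique {X : Type*} {N : ℝ≥0∞} {p : ℝ} {f : X → ℝ≥0∞} {i j : ℤ} {x : X}
    (hi : x ∈ lev N p f i) (hj : x ∈ lev N p f j) : i = j := by
  by_contra hne
  wlog hlt : i < j generalizing i j
  · exact this hj hi (Ne.symm hne) (by omega)
  have h1 := hi.2
  have h2 := hj.1
  have : (2:ℝ≥0∞)^((i:ℝ)+1) ≤ 2^(j:ℝ) := two_rpow_mono (by exact_mod_cast hlt)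
  exact absurd (h1.trans (mul_le_mul_left this (N^p))) (not_le.mpr h2)

lemma lev_exists {X : Type*} {N : ℝ≥0∞} {p : ℝ} {f : X → ℝ≥0∞} {x : X}
    (hN0 : N ≠ 0) (hN : N ≠ ⊤) (h0 : f x ≠ 0) (hx : f x ≠ ⊤) : ∃ j, x ∈ lev N p f j := by
  have hNp0 : N^p ≠ 0 := by simp [ENNReal.rpow_eq_zero_iff, hN0, hN]
  have hNp : N^p ≠ ⊤ := by simp [ENNReal.rpow_eq_top_iff, hN0, hN]
  have hfp0 : f x^p ≠ 0 := by simp [ENNReal.rpow_eq_zero_iff, h0, hx]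
  have hfp : f x^p ≠ ⊤ := by simp [ENNReal.rpow_eq_top_iff, h0, hx]
  obtain ⟨n, hn1, hn2⟩ := ENNReal.exists_mem_Ioc_zpow (x := f x^p / N^p) (y := 2)
    (by simp [ENNReal.div_eq_zero_iff, hfp0, hNp])
    (ENNReal.div_ne_top hfp hNp0) (by norm_num) (by norm_num)
  refine ⟨n, ?_, ?_⟩
  · rw [ENNReal.rpow_intCast]
    rwa [ENNReal.lt_div_iff_mul_lt (Or.inl hNp0) (Or.inl hNp)] at hn1
  · have : (n:ℝ)+1 = ((n+1:ℤ):ℝ) := by push_cast; rfl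
    rw [this, ENNReal.rpow_intCast]
    rwa [ENNReal.div_le_iff hNp0 hNp] at hn2

lemma lev_bound {X : Type*} {N : ℝ≥0∞} {p : ℝ} (hp : 1 ≤ p) {f : X → ℝ≥0∞} {x : X} {j : ℤ}
    (hx : x ∈ lev N p f j) : f x ≤ 2 * 2^((j:ℝ)*(1/p)) * N := by
  have hp0 : 0 < p := by linarith
  have h := hx.2
  have h2 : (f x^p)^(1/p) ≤ (2^((j:ℝ)+1) * N^p)^(1/p) := ENNReal.rpow_le_rpow h (by positivity)
  rw [ENNReal.mul_rpow_of_nonneg _ _ (by positivity), ← ENNReal.rpow_mul, ← ENNReal.rpow_mul,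
    ← ENNReal.rpow_mul, mul_one_div_cancel hp0.ne', ENNReal.rpow_one, ENNReal.rpow_one, add_mul,
    two_rpow_add] at h2
  refine h2.trans ?_
  rw [mul_comm (2:ℝ≥0∞) (2^_)]
  gcongr
  calc (2:ℝ≥0∞)^(1 * (1/p)) ≤ 2^(1:ℝ) := two_rpow_mono (by
        rw [one_mul]; exact (div_le_one hp0).mpr hp)
    _ = 2 := by simp

lemma lev_measurable {X : Type*} [MeasurableSpace X] {N : ℝ≥0∞} {p : ℝ} {f : X → ℝ≥0∞}
    (hf : Measurable f) (j : ℤ) : MeasurableSet (lev N p f j) := by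
  have h1 : MeasurableSet {x | 2^(j:ℝ) * N^p < f x^p} :=
    measurableSet_lt measurable_const (by fun_prop)
  have h2 : MeasurableSet {x | f x^p ≤ 2^((j:ℝ)+1) * N^p} :=
    measurableSet_le (by fun_prop) measurable_const
  exact h1.inter h2

lemma lev_sum {X : Type*} [MeasurableSpace X] (ν : Measure X) {N : ℝ≥0∞} {p : ℝ} (hp : 0 < p)
    {f : X → ℝ≥0∞}
    (hf : Measurable f) (hN : N ≠ ⊤) (hfN : ∫⁻ x, f x^p ∂ν ≤ N^p) :
    ∑' j : ℤ, 2^(j:ℝ) * ν (lev N p f j) ≤ 1 := by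
  by_cases hN0 : N = 0
  · have : ∀ j, lev N p f j = ∅ := by
      intro j
      ext x
      simp only [lev, hN0, ENNReal.zero_rpow_of_pos hp, mul_zero, Set.mem_ofPred_eq,
        Set.mem_empty_iff_false, iff_false, not_and, not_le]
      exact fun h => h
    simp [this]
  have hNp0 : N^p ≠ 0 := by simp [ENNReal.rpow_eq_zero_iff, hN0, hN]
  have hNp : N^p ≠ ⊤ := by simp [ENNReal.rpow_eq_top_iff, hN0, hN]
  have h1 : N^p * ∑' j : ℤ, 2^(j:ℝ) * ν (lev N p f j) ≤ N^p * 1 := by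
    rw [← ENNReal.tsum_mul_left, mul_one]
    refine le_trans ?_ hfN
    calc ∑' j : ℤ, N^p * (2^(j:ℝ) * ν (lev N p f j))
        ≤ ∑' j : ℤ, ∫⁻ x in lev N p f j, f x^p ∂ν := by
          apply ENNReal.tsum_le_tsum
          intro j
          rw [← mul_assoc, mul_comm (N^p)]
          rw [← setLIntegral_const]
          apply setLIntegral_mono' (lev_measurable hf j)
          intro x hx
          exact hx.1.le
      _ = ∫⁻ x in ⋃ j, lev N p f j, f x^p ∂ν := by
          rw [lintegral_iUnion (lev_measurable hf)]
          intro i j hij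
          rw [Function.onFun, Set.disjoint_left]
          intro x hi hj
          exact hij (lev_unique hi hj)
      _ ≤ ∫⁻ x, f x^p ∂ν := setLIntegral_le_lintegral _ _
  exact (ENNReal.mul_le_mul_iff_right hNp0 hNp).mp h1

lemma lintegral_comp_abs' (f : ℝ → ℝ≥0∞) :
    ∫⁻ u : ℝ, f |u| = 2 * ∫⁻ u in Set.Ioi 0, f u := by
  have h1 : ∫⁻ u in Set.Ioi (0:ℝ), f |u| = ∫⁻ u in Set.Ioi 0, f u := by
    apply setLIntegral_congr_fun measurableSet_Ioi
    intro u hu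
    simp only [abs_of_pos hu.out]
  have h2 : ∫⁻ u in Set.Iic (0:ℝ), f |u| = ∫⁻ u in Set.Ioi 0, f u := by
    rw [← h1, setLIntegral_congr Ioi_ae_eq_Ici, ← lintegral_indicator measurableSet_Iic,
      ← lintegral_neg_eq_self, ← lintegral_indicator measurableSet_Ici]
    congr 1; ext u
    simp [Set.indicator_apply]
  rw [← lintegral_add_compl (fun u => f |u|) (measurableSet_Ioi (a := (0:ℝ))), Set.compl_Ioi, h1, h2,
    two_mul]

lemma lint_near {α : ℝ} (h1 : α < 1) {δ : ℝ} (hδ : 0 < δ) :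
    ∫⁻ u : ℝ, (Set.Iio δ).indicator (fun v => (ENNReal.ofReal v)^(-α)) |u|
      ≤ ENNReal.ofReal (2 / (1-α)) * (ENNReal.ofReal δ)^(1-α) := by
  rw [lintegral_comp_abs']
  rw [setLIntegral_indicator measurableSet_Iio]
  have e : Set.Iio δ ∩ Set.Ioi 0 = Set.Ioo 0 δ := by ext; simp [and_comm]
  rw [e]
  have e2 : ∫⁻ v in Set.Ioo 0 δ, (ENNReal.ofReal v)^(-α) = ENNReal.ofReal (δ^(1-α)/(1-α)) := by
    have : ∫⁻ v in Set.Ioo 0 δ, (ENNReal.ofReal v)^(-α) = ∫⁻ v in Set.Ioo 0 δ, ENNReal.ofReal (v^(-α)) := by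
      apply setLIntegral_congr_fun measurableSet_Ioo
      intro v hv
      exact ENNReal.ofReal_rpow_of_pos hv.1
    rw [this, ← ofReal_integral_eq_lintegral_ofReal]
    · rw [← integral_Ioc_eq_integral_Ioo, ← intervalIntegral.integral_of_le hδ.le, integral_rpow (by left; linarith)]
      rw [Real.zero_rpow (by linarith)]
      congr 1
      rw [sub_zero]
      ring_nf
    · have := (intervalIntegral.intervalIntegrable_rpow' (a := 0) (b := δ) (r := -α) (by linarith))
      rw [intervalIntegrable_iff_integrableOn_Ioo_of_le hδ.le] at this
      exact this
    · filter_upwards [ae_restrict_mem measurableSet_Ioo] with v hv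
      exact Real.rpow_nonneg hv.1.le _
  rw [e2, ENNReal.ofReal_rpow_of_pos hδ, ← ENNReal.ofReal_mul (by apply div_nonneg <;> linarith)]
  rw [← ENNReal.ofReal_ofNat, ← ENNReal.ofReal_mul (by norm_num)]
  apply ENNReal.ofReal_le_ofReal
  apply le_of_eq; ring

lemma lint_far {σ : ℝ} (h1 : 1 < σ) {δ : ℝ} (hδ : 0 < δ) :
    ∫⁻ u : ℝ, (Set.Ici δ).indicator (fun v => (ENNReal.ofReal v)^(-σ)) |u|
      ≤ ENNReal.ofReal (2 / (σ-1)) * (ENNReal.ofReal δ)^(1-σ) := by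
  rw [lintegral_comp_abs']
  rw [setLIntegral_indicator measurableSet_Ici]
  have e : Set.Ici δ ∩ Set.Ioi 0 = Set.Ici δ := by
    ext x; simp; intro h; linarith
  rw [e]
  have e2 : ∫⁻ v in Set.Ici δ, (ENNReal.ofReal v)^(-σ) = ENNReal.ofReal (δ^(1-σ)/(σ-1)) := by
    have : ∫⁻ v in Set.Ici δ, (ENNReal.ofReal v)^(-σ) = ∫⁻ v in Set.Ioi δ, ENNReal.ofReal (v^(-σ)) := by
      rw [setLIntegral_congr Ioi_ae_eq_Ici.symm]
      apply setLIntegral_congr_fun measurableSet_Ioi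
      intro v hv
      exact ENNReal.ofReal_rpow_of_pos (hδ.trans hv)
    rw [this, ← ofReal_integral_eq_lintegral_ofReal]
    · rw [integral_Ioi_rpow_of_lt (by linarith) hδ]
      congr 1
      rw [show -σ+1 = -(σ-1) by ring, show 1-σ = -(σ-1) by ring, div_neg, neg_div, neg_neg]
    · exact integrableOn_Ioi_rpow_of_lt (by linarith) hδ
    · filter_upwards [ae_restrict_mem measurableSet_Ioi] with v hv
      exact Real.rpow_nonneg (hδ.trans hv).le _
  rw [e2, ENNReal.ofReal_rpow_of_pos hδ, ← ENNReal.ofReal_mul (by apply div_nonneg <;> linarith)]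
  rw [← ENNReal.ofReal_ofNat, ← ENNReal.ofReal_mul (by norm_num)]
  apply ENNReal.ofReal_le_ofReal
  apply le_of_eq; ring

/-- the singular kernel -/
def ker (α s t : ℝ) : ℝ≥0∞ := (ENNReal.ofReal |t - s|)^(-α)

lemma ker_symm (α s t : ℝ) : ker α s t = ker α t s := by
  unfold ker; rw [abs_sub_comm]

@[fun_prop]
lemma ker_meas (α : ℝ) : Measurable (fun z : ℝ × ℝ => ker α z.1 z.2) := by
  unfold ker; fun_prop

lemma ker_set {α : ℝ} (h0 : 0 < α) (h1 : α < 1) {δ : ℝ} (hδ : 0 < δ) (s : ℝ) (E : Set ℝ) :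
    ∫⁻ t in E, ker α s t ≤ ENNReal.ofReal (2 / (1-α)) * (ENNReal.ofReal δ)^(1-α)
      + (ENNReal.ofReal δ)^(-α) * volume E := by
  have h : ∀ t, ker α s t ≤ (Set.Iio δ).indicator (fun v => (ENNReal.ofReal v)^(-α)) |t - s|
      + (ENNReal.ofReal δ)^(-α) := by
    intro t
    by_cases ht : |t - s| < δ
    · rw [Set.indicator_of_mem (show |t-s| ∈ Set.Iio δ from ht)]
      exact le_self_add
    · refine le_trans ?_ le_add_self
      unfold ker
      rw [ENNReal.rpow_neg, ENNReal.rpow_neg]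
      gcongr
      exact not_lt.mp ht
  calc ∫⁻ t in E, ker α s t
      ≤ ∫⁻ t in E, ((Set.Iio δ).indicator (fun v => (ENNReal.ofReal v)^(-α)) |t - s|
      + (ENNReal.ofReal δ)^(-α)) := lintegral_mono h
    _ = (∫⁻ t in E, (Set.Iio δ).indicator (fun v => (ENNReal.ofReal v)^(-α)) |t - s|)
      + (ENNReal.ofReal δ)^(-α) * volume E := by
        rw [lintegral_add_right _ measurable_const, setLIntegral_const]
    _ ≤ (∫⁻ t, (Set.Iio δ).indicator (fun v => (ENNReal.ofReal v)^(-α)) |t - s|)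
      + (ENNReal.ofReal δ)^(-α) * volume E := by
        gcongr; exact Measure.restrict_le_self
    _ ≤ _ := by
        gcongr
        rw [lintegral_sub_right_eq_self (fun t => (Set.Iio δ).indicator (fun v => (ENNReal.ofReal v)^(-α)) |t|) s]
        exact lint_near h1 hδ

lemma ker_pair {α : ℝ} (h0 : 0 < α) (h1 : α < 1) (E E' : Set ℝ) (l : ℤ)
    (hE' : (2:ℝ≥0∞)^(l:ℝ) * volume E' ≤ 1) :
    ∫⁻ s in E, ∫⁻ t in E', ker α s t ≤
      (ENNReal.ofReal (2 / (1-α)) + 1) * 2^(-(l:ℝ)*(1-α)) * volume E := by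
  rw [← setLIntegral_const]
  apply lintegral_mono
  intro s
  have hδ : (0:ℝ) < 2^(-(l:ℝ)) := by positivity
  refine (ker_set h0 h1 hδ s E').trans ?_
  have e : ENNReal.ofReal ((2:ℝ)^(-(l:ℝ))) = 2^(-(l:ℝ)) := by
    rw [← ENNReal.ofReal_rpow_of_pos (by norm_num)]; simp
  rw [e, ← ENNReal.rpow_mul, ← ENNReal.rpow_mul, add_mul, one_mul]
  refine add_le_add le_rfl ?_
  calc (2:ℝ≥0∞)^(-(l:ℝ) * -α) * volume E' = 2^(-(l:ℝ)*(1-α)) * (2^(l:ℝ) * volume E') := by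
        rw [← mul_assoc, ← two_rpow_add]; ring_nf
    _ ≤ _ := by
        calc _ ≤ (2:ℝ≥0∞)^(-(l:ℝ)*(1-α)) * 1 := by gcongr
          _ = _ := mul_one _

lemma ker_swap (α : ℝ) (E E' : Set ℝ) :
    ∫⁻ s in E, ∫⁻ t in E', ker α s t = ∫⁻ s in E', ∫⁻ t in E, ker α s t := by
  rw [lintegral_lintegral_swap (by fun_prop)]
  simp_rw [ker_symm α]

lemma ker_pair' {α : ℝ} (h0 : 0 < α) (h1 : α < 1) (M : ℤ → Set ℝ)
    (hM : ∀ l : ℤ, (2:ℝ≥0∞)^(l:ℝ) * volume (M l) ≤ 1) (j l : ℤ) :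
    2^((j:ℝ)*(1-α/2)) * 2^((l:ℝ)*(1-α/2)) * ∫⁻ s in M j, ∫⁻ t in M l, ker α s t ≤
      (ENNReal.ofReal (2 / (1-α)) + 1) * (2^(-(α/2*|((j-l:ℤ):ℝ)|)) *
       (2^(j:ℝ) * volume (M j) + 2^(l:ℝ) * volume (M l))) := by
  wlog hlj : l ≤ j generalizing j l
  · have := this l j (by omega)
    rw [ker_swap, mul_comm (2^((j:ℝ)*(1-α/2))), add_comm (2^(j:ℝ) * _)]
    refine this.trans (le_of_eq ?_)
    congr 5
    push_cast
    rw [abs_sub_comm]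
  have := ker_pair h0 h1 (M j) (M l) l (hM l)
  have hlj' : (l:ℝ) ≤ j := by exact_mod_cast hlj
  calc _ ≤ 2^((j:ℝ)*(1-α/2)) * 2^((l:ℝ)*(1-α/2)) *
        ((ENNReal.ofReal (2 / (1-α)) + 1) * 2^(-(l:ℝ)*(1-α)) * volume (M j)) := by gcongr
    _ = (ENNReal.ofReal (2 / (1-α)) + 1) * (2^(-(α/2*|((j-l:ℤ):ℝ)|)) *
       (2^(j:ℝ) * volume (M j))) := by
        have e : (2:ℝ≥0∞)^((j:ℝ)*(1-α/2)) * 2^((l:ℝ)*(1-α/2)) * 2^(-(l:ℝ)*(1-α)) =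
          2^(-(α/2*|((j-l:ℤ):ℝ)|)) * 2^(j:ℝ) := by
          rw [← two_rpow_add, ← two_rpow_add, ← two_rpow_add]
          congr 1
          push_cast
          rw [abs_of_nonneg (by linarith)]
          ring
        calc _ = ((2:ℝ≥0∞)^((j:ℝ)*(1-α/2)) * 2^((l:ℝ)*(1-α/2)) * 2^(-(l:ℝ)*(1-α))) *
            ((ENNReal.ofReal (2 / (1-α)) + 1) * volume (M j)) := by ring
          _ = _ := by rw [e]; ring
    _ ≤ _ := by gcongr; exact le_self_add

lemma hls {α : ℝ} (h0 : 0 < α) (h1 : α < 1) : ∃ C : ℝ≥0∞, C ≠ ⊤ ∧ C ≠ 0 ∧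
    ∀ f : ℝ → ℝ≥0∞, Measurable f →
      ∫⁻ s, ∫⁻ t, ker α s t * (f s * f t) ≤ C * (∫⁻ t, f t^(2/(2-α)))^(2-α) := by
  set C0 := ENNReal.ofReal (2 / (1-α)) + 1 with hC0
  refine ⟨8 * C0 * geoSum (α/2) + 1, ?_, by simp, ?_⟩
  · have := geoSum_ne_top (half_pos h0)
    have h3 : C0 ≠ ⊤ := by simp [hC0]
    finiteness
  intro f hf
  set p := 2/(2-α) with hp
  have hp1 : 1 ≤ p := by rw [hp, le_div_iff₀ (by linarith)]; linarith
  have hp0 : 0 < p := by linarith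
  have hip : 1/p = 1-α/2 := by rw [hp]; field_simp
  set N := (∫⁻ t, f t^p)^(1/p) with hN
  have hNp : N^p = ∫⁻ t, f t^p := by
    rw [hN, ← ENNReal.rpow_mul, one_div_mul_cancel hp0.ne', ENNReal.rpow_one]
  have hN2 : (∫⁻ t, f t^p)^(2-α) = N^2 := by
    rw [← hNp, ← ENNReal.rpow_mul, ← ENNReal.rpow_natCast]
    congr 1
    rw [hp]; have : 2 - α ≠ 0 := by linarith
    field_simp; norm_num
  rw [hN2]
  by_cases hNtop : N = ⊤
  · rw [hNtop]; simp
  by_cases hN0 : N = 0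
  · have : ∫⁻ t, f t^p = 0 := by rw [← hNp, hN0, ENNReal.zero_rpow_of_pos hp0]
    rw [lintegral_eq_zero_iff (by fun_prop)] at this
    have hfz : f =ᵐ[volume] 0 := by
      filter_upwards [this] with t ht
      simp only [Pi.zero_apply, ENNReal.rpow_eq_zero_iff] at ht ⊢
      rcases ht with h | h
      · exact h.1
      · linarith [h.2]
    have : ∫⁻ s, ∫⁻ t, ker α s t * (f s * f t) = 0 := by
      rw [lintegral_eq_zero_iff (by fun_prop)]
      filter_upwards [hfz] with s hs
      simp [hs]
    rw [this]; exact zero_le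
  have hfin : ∀ᵐ t, f t ≠ ⊤ := by
    have : ∀ᵐ t, f t^p < ⊤ := ae_lt_top (by fun_prop) (by
      rw [← hNp]; exact ENNReal.rpow_ne_top_of_nonneg hp0.le hNtop)
    filter_upwards [this] with t ht h
    rw [h, ENNReal.top_rpow_of_pos hp0] at ht
    exact lt_irrefl _ ht
  set E := lev N p f with hE
  have hEm : ∀ j, MeasurableSet (E j) := lev_measurable hf
  have hsum : ∑' j : ℤ, 2^(j:ℝ) * volume (E j) ≤ 1 := lev_sum volume hp0 hf hNtop hNp.symm.le
  set b : ℤ → ℝ → ℝ≥0∞ := fun j => (E j).indicator (fun _ => 2 * 2^((j:ℝ)*(1-α/2)) * N) with hb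
  have hbm : ∀ j, Measurable (b j) := fun j => measurable_const.indicator (hEm j)
  have hfb : ∀ᵐ t, f t ≤ ∑' j, b j t := by
    filter_upwards [hfin] with t ht
    by_cases hft : f t = 0
    · rw [hft]; exact zero_le
    obtain ⟨j, hj⟩ := lev_exists (p := p) hN0 hNtop hft ht
    refine le_trans ?_ (ENNReal.le_tsum j)
    have := lev_bound hp1 hj
    rw [hb]
    simp only
    rw [Set.indicator_of_mem hj, ← hip]
    exact this
  calc ∫⁻ s, ∫⁻ t, ker α s t * (f s * f t)
      ≤ ∫⁻ s, ∫⁻ t, ker α s t * ((∑' j, b j s) * (∑' l, b l t)) := by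
        apply lintegral_mono_ae
        filter_upwards [hfb] with s hs
        apply lintegral_mono_ae
        filter_upwards [hfb] with t ht
        gcongr
    _ = ∑' j, ∑' l, ∫⁻ s, ∫⁻ t, ker α s t * (b j s * b l t) := by
        have : ∀ s t, ker α s t * ((∑' j, b j s) * (∑' l, b l t)) =
            ∑' j, ∑' l, ker α s t * (b j s * b l t) := by
          intro s t
          rw [← ENNReal.tsum_mul_right, ← ENNReal.tsum_mul_left]
          congr 1; ext j
          rw [← ENNReal.tsum_mul_left, ← ENNReal.tsum_mul_left]
        simp_rw [this]
        have m1 : ∀ j l, Measurable (fun z : ℝ × ℝ => ker α z.1 z.2 * (b j z.1 * b l z.2)) := by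
          intro j l
          have := hbm j
          have := hbm l
          fun_prop
        have m2 : ∀ j, Measurable (fun z : ℝ × ℝ => ∑' l, ker α z.1 z.2 * (b j z.1 * b l z.2)) :=
          fun j => Measurable.tsum (m1 j)
        have n1 : ∀ j l s, Measurable (fun t => ker α s t * (b j s * b l t)) := fun j l s =>
          (m1 j l).comp (by fun_prop : Measurable (fun t : ℝ => (s, t)))
        have n2 : ∀ j s, Measurable (fun t => ∑' l, ker α s t * (b j s * b l t)) := fun j s =>
          (m2 j).comp (by fun_prop : Measurable (fun t : ℝ => (s, t)))
        have e1 : ∀ s, ∫⁻ t, ∑' j, ∑' l, ker α s t * (b j s * b l t)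
            = ∑' j, ∑' l, ∫⁻ t, ker α s t * (b j s * b l t) := by
          intro s
          rw [lintegral_tsum (fun j => (n2 j s).aemeasurable)]
          congr 1; ext j
          rw [lintegral_tsum (fun l => (n1 j l s).aemeasurable)]
        simp_rw [e1]
        have m3 : ∀ j l, Measurable (fun s => ∫⁻ t, ker α s t * (b j s * b l t)) :=
          fun j l => (m1 j l).lintegral_prod_right'
        rw [lintegral_tsum (fun j => (Measurable.tsum (m3 j)).aemeasurable)]
        congr 1; ext j
        rw [lintegral_tsum (fun l => (m3 j l).aemeasurable)]
    _ ≤ ∑' j : ℤ, ∑' l : ℤ, (4 * C0 * N^2) * (2^(-(α/2*|((j-l:ℤ):ℝ)|)) *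
       (2^(j:ℝ) * volume (E j) + 2^(l:ℝ) * volume (E l))) := by
        gcongr with j l
        have e : ∀ s t, ker α s t * (b j s * b l t) =
           (4 * N^2 * 2^((j:ℝ)*(1-α/2)) * 2^((l:ℝ)*(1-α/2))) *
            ((E j).indicator (fun s => (E l).indicator (fun t => ker α s t) t) s) := by
          intro s t
          simp only [hb]
          by_cases hs : s ∈ E j <;> by_cases ht : t ∈ E l <;> simp [hs, ht]
          ring
        simp_rw [e]
        have hc : (4 * N^2 * 2^((j:ℝ)*(1-α/2)) * 2^((l:ℝ)*(1-α/2))) ≠ (⊤:ℝ≥0∞) := by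
          have := two_rpow_ne_top
          finiteness
        simp_rw [lintegral_const_mul' _ _ hc]
        have e3 : ∫⁻ s, ∫⁻ t, (E j).indicator (fun s => (E l).indicator (fun t => ker α s t) t) s =
            ∫⁻ s in E j, ∫⁻ t in E l, ker α s t := by
          rw [← lintegral_indicator (hEm j)]
          congr 1; ext s
          by_cases hs : s ∈ E j
          · simp only [Set.indicator_of_mem hs]
            rw [lintegral_indicator (hEm l)]
          · simp only [Set.indicator_of_notMem hs, lintegral_zero]
        rw [e3]
        have := ker_pair' h0 h1 E (fun l => (ENNReal.le_tsum l).trans hsum) j l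
        calc _ = 4 * N^2 * (2^((j:ℝ)*(1-α/2)) * 2^((l:ℝ)*(1-α/2)) * ∫⁻ s in E j, ∫⁻ t in E l, ker α s t) := by ring
          _ ≤ 4 * N^2 * (C0 * (2^(-(α/2*|((j-l:ℤ):ℝ)|)) *
               (2^(j:ℝ) * volume (E j) + 2^(l:ℝ) * volume (E l)))) := by gcongr
          _ = _ := by ring
    _ = (4 * C0 * N^2) * (geoSum (α/2) * (∑' j : ℤ, 2^(j:ℝ) * volume (E j) + ∑' j : ℤ, 2^(j:ℝ) * volume (E j))) := by
        simp_rw [ENNReal.tsum_mul_left]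
        congr 1
        exact schur_diff (fun i : ℤ => (2:ℝ≥0∞)^(-(α/2*|(i:ℝ)|))) _ _
    _ ≤ (4 * C0 * N^2) * (geoSum (α/2) * (1 + 1)) := by gcongr
    _ = (8 * C0 * geoSum (α/2)) * N^2 := by ring
    _ ≤ _ := by gcongr; exact le_self_add

/-- Abstract dispersive family of vectors. -/
structure Disp {X H : Type*} [MeasurableSpace X] [NormedAddCommGroup H] [InnerProductSpace ℂ H]
    (ν : Measure X) (σ : ℝ) (Φ : ℝ → X → H) : Prop where
  meas : StronglyMeasurable (fun z : ℝ × X => Φ z.1 z.2)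
  bdd : ∃ B : ℝ, ∀ t x, ‖Φ t x‖ ≤ B
  l2 : ∀ t (f : X → ℂ), Integrable f ν → ‖∫ x, f x • Φ t x ∂ν‖ₑ^2 ≤ ∫⁻ x, ‖f x‖ₑ^2 ∂ν
  disp : ∀ t s x y, ‖inner ℂ (Φ t x) (Φ s y)‖ₑ ≤ ker σ t s

set_option linter.unusedSectionVars false
section
variable {X H : Type*} [MeasurableSpace X] [NormedAddCommGroup H] [InnerProductSpace ℂ H]
  [CompleteSpace H] {ν : Measure X} [SFinite ν] {σ : ℝ} {Φ : ℝ → X → H}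

lemma enorm_inner_integral_le {Y : Type*} [MeasurableSpace Y] {μ : Measure Y} (V : H) {a : Y → H}
    (ha : Integrable a μ) : ‖inner ℂ V (∫ y, a y ∂μ)‖ₑ ≤ ∫⁻ y, ‖inner ℂ V (a y)‖ₑ ∂μ := by
  rw [← integral_inner ha]
  exact enorm_integral_le_lintegral_enorm _

lemma enorm_inner_symm (a b : H) : ‖inner ℂ a b‖ₑ = ‖inner ℂ b a‖ₑ := by
  rw [← ofReal_norm, ← ofReal_norm, norm_inner_symm]

lemma enorm_inner_le (a b : H) : ‖inner ℂ a b‖ₑ ≤ ‖a‖ₑ * ‖b‖ₑ := by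
  rw [← ofReal_norm, ← ofReal_norm, ← ofReal_norm,
    ← ENNReal.ofReal_mul (norm_nonneg _)]
  exact ENNReal.ofReal_le_ofReal (norm_inner_le_norm _ _)

lemma Disp.smul_integrable (h : Disp ν σ Φ) (t : ℝ) {f : X → ℂ} (hf : Integrable f ν) :
    Integrable (fun x => f x • Φ t x) ν := by
  obtain ⟨B, hB⟩ := h.bdd
  have : StronglyMeasurable (Φ t) := h.meas.comp_measurable (by fun_prop : Measurable (fun x : X => (t, x)))
  refine Integrable.mono' (hf.norm.mul_const B) (hf.1.smul this.aestronglyMeasurable) ?_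
  filter_upwards with x
  rw [norm_smul]
  gcongr
  exact hB t x

lemma Disp.inner_le (h : Disp ν σ Φ) (t s : ℝ) {f g : X → ℂ} (hf : Integrable f ν)
    (hg : Integrable g ν) :
    ‖inner ℂ (∫ x, f x • Φ t x ∂ν) (∫ x, g x • Φ s x ∂ν)‖ₑ ≤
      ker σ t s * ((∫⁻ x, ‖f x‖ₑ ∂ν) * ∫⁻ x, ‖g x‖ₑ ∂ν) := by
  set V := ∫ x, f x • Φ t x ∂ν with hV
  have h1 : ∀ y, ‖inner ℂ V (Φ s y)‖ₑ ≤ ker σ t s * ∫⁻ x, ‖f x‖ₑ ∂ν := by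
    intro y
    rw [enorm_inner_symm]
    refine (enorm_inner_integral_le _ (h.smul_integrable t hf)).trans ?_
    rw [← lintegral_const_mul'' _ hf.1.enorm]
    apply lintegral_mono
    intro x
    simp only
    rw [inner_smul_right, enorm_mul, mul_comm, ker_symm]
    gcongr
    exact h.disp s t y x
  refine (enorm_inner_integral_le _ (h.smul_integrable s hg)).trans ?_
  rw [← mul_assoc, ← lintegral_const_mul'' _ hg.1.enorm]
  apply lintegral_mono
  intro x
  simp only
  rw [inner_smul_right, enorm_mul, mul_comm]
  gcongr
  exact h1 x

lemma Disp.atoms (h : Disp ν σ Φ) {p : ℝ} (hp1 : 1 ≤ p) {F : ℝ → X → ℂ}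
    (hF : Measurable (fun z : ℝ × X => F z.1 z.2)) {N : ℝ → ℝ≥0∞} (hN : Measurable N)
    (hNtop : ∀ t, N t ≠ ⊤) (hFN : ∀ t, ∫⁻ x, ‖F t x‖ₑ^p ∂ν ≤ N t^p) (hNint : ∫⁻ t, N t ≠ ⊤) :
    ∃ (a : ℤ → ℝ → H) (g : ℤ → ℝ → ℝ≥0∞), (∀ j, Integrable (a j)) ∧ (∀ j, Measurable (g j)) ∧
      (∀ t, ∑' j, g j t^2 ≤ 1) ∧
      (∀ j t, ‖a j t‖ₑ ≤ 2 * 2^((j:ℝ)*(1/p-1/2)) * (N t * g j t)) ∧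
      (∀ j l s t, ‖inner ℂ (a j s) (a l t)‖ₑ ≤
        4 * ker σ s t * (2^((j:ℝ)*(1/p-1)) * 2^((l:ℝ)*(1/p-1))) * ((N s * g j s) * (N t * g l t))) ∧
      (∀ (w : H) (M : ℝ≥0∞),
        (∀ t x, F t x * inner ℂ w (Φ t x) = ((‖F t x‖ * ‖inner ℂ w (Φ t x)‖ : ℝ) : ℂ)) →
        (∀ s : Finset ℤ, ‖∑ j ∈ s, ∫ t, a j t‖ₑ ≤ M) →
        ∫⁻ t, ∫⁻ x, ‖F t x‖ₑ * ‖inner ℂ w (Φ t x)‖ₑ ∂ν ≤ ‖w‖ₑ * M) := by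
  have hp0 : 0 < p := by linarith
  set S : ℤ → ℝ → Set X := fun j t => lev (N t) p (fun x => ‖F t x‖ₑ) j with hS
  have hFt : ∀ t, Measurable (F t) := fun t => hF.comp (by fun_prop : Measurable (fun x : X => (t, x)))
  have hSm : ∀ j t, MeasurableSet (S j t) := fun j t => lev_measurable (hFt t).enorm j
  have hSm2 : ∀ j, MeasurableSet {z : ℝ × X | z.2 ∈ S j z.1} := by
    intro j
    have h1 : MeasurableSet {z : ℝ × X | 2^(j:ℝ) * N z.1^p < ‖F z.1 z.2‖ₑ^p} :=
      measurableSet_lt (by fun_prop) (by fun_prop)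
    have h2 : MeasurableSet {z : ℝ × X | ‖F z.1 z.2‖ₑ^p ≤ 2^((j:ℝ)+1) * N z.1^p} :=
      measurableSet_le (by fun_prop) (by fun_prop)
    exact h1.inter h2
  set G : ℤ → ℝ → X → ℂ := fun j t => (S j t).indicator (F t) with hG
  have hGm : ∀ j, Measurable (fun z : ℝ × X => G j z.1 z.2) := by
    intro j
    have := hF.indicator (hSm2 j)
    convert this using 1
    ext z
    by_cases hz : z.2 ∈ S j z.1
    · rw [Set.indicator_of_mem (show z ∈ {z : ℝ × X | z.2 ∈ S j z.1} from hz)]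
      simp only [hG]; rw [Set.indicator_of_mem hz]
    · rw [Set.indicator_of_notMem (show z ∉ {z : ℝ × X | z.2 ∈ S j z.1} from hz)]
      simp only [hG]; rw [Set.indicator_of_notMem hz]
  have hGmt : ∀ j t, Measurable (G j t) := fun j t => (hFt t).indicator (hSm j t)
  have hMm : ∀ j, Measurable (fun t => ν (S j t)) := fun j => measurable_measure_prodMk_left (hSm2 j)
  set x : ℤ → ℝ → ℝ≥0∞ := fun j t => 2^(j:ℝ) * ν (S j t) with hx
  have hxm : ∀ j, Measurable (x j) := fun j => (hMm j).const_mul _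
  have hxsum : ∀ t, ∑' j, x j t ≤ 1 := fun t => lev_sum ν hp0 (hFt t).enorm (hNtop t) (hFN t)
  have hx1 : ∀ j t, x j t ≤ 1 := fun j t => (ENNReal.le_tsum j).trans (hxsum t)
  have hMx : ∀ j t, ν (S j t) = 2^(-(j:ℝ)) * x j t := by
    intro j t
    simp only [hx]
    rw [← mul_assoc, ← two_rpow_add]; simp
  set g : ℤ → ℝ → ℝ≥0∞ := fun j t => (x j t)^(1/2:ℝ) with hg
  have hg2 : ∀ j t, g j t^2 = x j t := by
    intro j t
    simp only [hg]
    rw [← ENNReal.rpow_natCast, ← ENNReal.rpow_mul]; norm_num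
  have hxg : ∀ j t, x j t ≤ g j t := by
    intro j t
    simp only [hg]
    calc x j t = (x j t)^(1:ℝ) := (ENNReal.rpow_one _).symm
      _ ≤ _ := ENNReal.rpow_le_rpow_of_exponent_ge (hx1 j t) (by norm_num)
  have hgm : ∀ j, Measurable (g j) := fun j => (hxm j).pow_const _
  have hGb : ∀ j t y, ‖G j t y‖ₑ ≤ (S j t).indicator (fun _ => 2 * 2^((j:ℝ)*(1/p)) * N t) y := by
    intro j t y
    by_cases hy : y ∈ S j t
    · simp only [hG, Set.indicator_of_mem hy]
      exact lev_bound hp1 hy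
    · simp [hG, Set.indicator_of_notMem hy]
  have hG1 : ∀ j t, ∫⁻ y, ‖G j t y‖ₑ ∂ν ≤ 2 * 2^((j:ℝ)*(1/p-1)) * (N t * g j t) := by
    intro j t
    calc _ ≤ ∫⁻ y, (S j t).indicator (fun _ => 2 * 2^((j:ℝ)*(1/p)) * N t) y ∂ν := lintegral_mono (hGb j t)
      _ = 2 * 2^((j:ℝ)*(1/p)) * N t * ν (S j t) := by rw [lintegral_indicator_const (hSm j t)]
      _ = 2 * 2^((j:ℝ)*(1/p-1)) * (N t * x j t) := by
        rw [hMx, show (j:ℝ)*(1/p-1) = (j:ℝ)*(1/p) + -(j:ℝ) by ring, two_rpow_add]; ring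
      _ ≤ _ := by gcongr; exact hxg j t
  have hG2 : ∀ j t, ∫⁻ y, ‖G j t y‖ₑ^2 ∂ν ≤ (2 * 2^((j:ℝ)*(1/p-1/2)) * (N t * g j t))^2 := by
    intro j t
    calc _ ≤ ∫⁻ y, (S j t).indicator (fun _ => (2 * 2^((j:ℝ)*(1/p)) * N t)^2) y ∂ν := by
          apply lintegral_mono
          intro y
          have := hGb j t y
          by_cases hy : y ∈ S j t
          · simp only [Set.indicator_of_mem hy] at this ⊢
            gcongr
          · simp only [Set.indicator_of_notMem hy] at this ⊢
            rw [le_zero_iff.mp this]; simp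
      _ = (2 * 2^((j:ℝ)*(1/p)) * N t)^2 * ν (S j t) := by rw [lintegral_indicator_const (hSm j t)]
      _ = (2 * 2^((j:ℝ)*(1/p-1/2)) * (N t * g j t))^2 := by
        rw [hMx, ← hg2]
        have e : (2:ℝ≥0∞)^(-(j:ℝ)) = (2^(-(j:ℝ)/2))^2 := by
          rw [← ENNReal.rpow_natCast, ← ENNReal.rpow_mul]; norm_num
        rw [e, show (j:ℝ)*(1/p-1/2) = (j:ℝ)*(1/p) + -(j:ℝ)/2 by ring, two_rpow_add]; ring
  have hg1 : ∀ j t, g j t ≤ 1 := fun j t => ENNReal.rpow_le_one (hx1 j t) (by norm_num)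
  have hGint : ∀ j t, Integrable (G j t) ν := by
    intro j t
    refine ⟨(hGmt j t).aestronglyMeasurable, lt_of_le_of_lt (hG1 j t) ?_⟩
    have := hNtop t
    have := (hg1 j t).trans_lt ENNReal.one_lt_top
    have := two_rpow_ne_top ((j:ℝ)*(1/p-1))
    finiteness
  have hGprod : ∀ j, Integrable (fun z : ℝ × X => G j z.1 z.2) ((volume : Measure ℝ).prod ν) := by
    intro j
    refine ⟨(hGm j).aestronglyMeasurable, ?_⟩
    rw [HasFiniteIntegral, lintegral_prod _ (by fun_prop)]
    calc _ ≤ ∫⁻ t, 2 * 2^((j:ℝ)*(1/p-1)) * N t := by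
          apply lintegral_mono
          intro t
          refine (hG1 j t).trans ?_
          refine mul_le_mul' le_rfl ?_
          calc N t * g j t ≤ N t * 1 := by gcongr; exact hg1 j t
            _ = _ := mul_one _
      _ = 2 * 2^((j:ℝ)*(1/p-1)) * ∫⁻ t, N t := lintegral_const_mul _ hN
      _ < ⊤ := by
        have := two_rpow_ne_top ((j:ℝ)*(1/p-1))
        finiteness
  have hΦprod : ∀ j, Integrable (fun z : ℝ × X => G j z.1 z.2 • Φ z.1 z.2) ((volume : Measure ℝ).prod ν) := by
    intro j
    obtain ⟨B, hB⟩ := h.bdd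
    refine Integrable.mono' ((hGprod j).norm.mul_const B) ((hGprod j).1.smul h.meas.aestronglyMeasurable) ?_
    filter_upwards with z
    rw [norm_smul]
    gcongr
    exact hB z.1 z.2
  refine ⟨fun j t => ∫ y, G j t y • Φ t y ∂ν, g, fun j => (hΦprod j).integral_prod_left, hgm, ?_, ?_, ?_, ?_⟩
  · intro t; simp_rw [hg2]; exact hxsum t
  · intro j t
    have := (h.l2 t _ (hGint j t)).trans (hG2 j t)
    exact (ENNReal.pow_le_pow_left_iff two_ne_zero).mp this
  · intro j l s t
    refine (h.inner_le s t (hGint j s) (hGint l t)).trans ?_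
    calc _ ≤ ker σ s t * ((2 * 2^((j:ℝ)*(1/p-1)) * (N s * g j s)) * (2 * 2^((l:ℝ)*(1/p-1)) * (N t * g l t))) := by
          gcongr
          · exact hG1 j s
          · exact hG1 l t
      _ = _ := by ring
  · intro w M hw hM
    have hip : Measurable (fun z : ℝ × X => inner ℂ w (Φ z.1 z.2)) :=
      (StronglyMeasurable.inner stronglyMeasurable_const h.meas).measurable
    have hipt : ∀ t, Measurable (fun y => inner ℂ w (Φ t y)) := fun t =>
      hip.comp (by fun_prop : Measurable (fun x : X => (t, x)))
    set P : ℤ → ℝ≥0∞ := fun j => ∫⁻ t, ∫⁻ y, ‖G j t y‖ₑ * ‖inner ℂ w (Φ t y)‖ₑ ∂ν with hP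
    have hPprod : ∀ j, P j = ∫⁻ z, ‖G j z.1 z.2 * inner ℂ w (Φ z.1 z.2)‖ₑ ∂((volume : Measure ℝ).prod ν) := by
      intro j
      have := hGm j
      rw [lintegral_prod _ (by fun_prop)]
      simp only [hP, enorm_mul]
    have hGint : ∀ j, Integrable (fun z : ℝ × X => G j z.1 z.2 * inner ℂ w (Φ z.1 z.2)) ((volume : Measure ℝ).prod ν) := by
      intro j
      have := (hΦprod j).const_inner (𝕜 := ℂ) w
      simpa only [inner_smul_right] using this
    have hPtop : ∀ j, P j ≠ ⊤ := by
      intro j; rw [hPprod]; exact (hGint j).2.ne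
    have hinner : ∀ j, inner ℂ w (∫ t, ∫ y, G j t y • Φ t y ∂ν) = (((P j).toReal : ℝ) : ℂ) := by
      intro j
      rw [← integral_prod (fun z : ℝ × X => G j z.1 z.2 • Φ z.1 z.2) (hΦprod j),
        ← integral_inner (hΦprod j), hPprod, ← integral_norm_eq_lintegral_enorm (hGint j).1,
        ← integral_complex_ofReal]
      congr 1; ext z
      rw [inner_smul_right]
      by_cases hz : z.2 ∈ S j z.1
      · simp only [hG, Set.indicator_of_mem hz]
        rw [hw, Complex.norm_real, Real.norm_of_nonneg (by positivity)]
      · simp [hG, Set.indicator_of_notMem hz]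
    have hfin : ∀ s : Finset ℤ, ∑ j ∈ s, P j ≤ ‖w‖ₑ * M := by
      intro s
      have e : inner ℂ w (∑ j ∈ s, ∫ t, ∫ y, G j t y • Φ t y ∂ν) = ((∑ j ∈ s, (P j).toReal : ℝ) : ℂ) := by
        rw [inner_sum]; push_cast
        exact Finset.sum_congr rfl (fun j _ => hinner j)
      calc ∑ j ∈ s, P j = ENNReal.ofReal (∑ j ∈ s, (P j).toReal) := by
            rw [ENNReal.ofReal_sum_of_nonneg (fun _ _ => ENNReal.toReal_nonneg)]
            exact Finset.sum_congr rfl (fun j _ => (ENNReal.ofReal_toReal (hPtop j)).symm)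
        _ = ‖inner ℂ w (∑ j ∈ s, ∫ t, ∫ y, G j t y • Φ t y ∂ν)‖ₑ := by
            rw [e, ← ofReal_norm, Complex.norm_real, Real.norm_of_nonneg]
            exact Finset.sum_nonneg (fun _ _ => ENNReal.toReal_nonneg)
        _ ≤ ‖w‖ₑ * ‖∑ j ∈ s, ∫ t, ∫ y, G j t y • Φ t y ∂ν‖ₑ := enorm_inner_le _ _
        _ ≤ _ := by gcongr; exact hM s
    have htsum : ∑' j, P j ≤ ‖w‖ₑ * M := by
      rw [ENNReal.tsum_eq_iSup_sum]; exact iSup_le hfin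
    refine le_trans ?_ htsum
    have e1 : ∑' j, P j = ∫⁻ t, ∑' j, ∫⁻ y, ‖G j t y‖ₑ * ‖inner ℂ w (Φ t y)‖ₑ ∂ν := by
      rw [lintegral_tsum]
      intro j
      have := hGm j
      exact (Measurable.lintegral_prod_right' (f := fun z : ℝ × X => ‖G j z.1 z.2‖ₑ * ‖inner ℂ w (Φ z.1 z.2)‖ₑ) (by fun_prop)).aemeasurable
    rw [e1]
    apply lintegral_mono
    intro t
    simp only
    rw [← lintegral_tsum (fun j => by have := hGmt j t; have := hipt t; fun_prop)]
    apply lintegral_mono_ae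
    by_cases hNt : N t = 0
    · have h0 : ∫⁻ x, ‖F t x‖ₑ^p ∂ν = 0 := by
        have := hFN t
        rw [hNt, ENNReal.zero_rpow_of_pos hp0] at this
        exact le_zero_iff.mp this
      have := hFt t
      rw [lintegral_eq_zero_iff (by fun_prop)] at h0
      filter_upwards [h0] with y hy
      simp only [Pi.zero_apply, ENNReal.rpow_eq_zero_iff, hp0, and_true, not_lt.mpr hp0.le, and_false, or_false] at hy
      simp [hy]
    · filter_upwards with y
      by_cases hy : F t y = 0
      · simp [hy]
      obtain ⟨j, hj⟩ := lev_exists (p := p) (f := fun y => ‖F t y‖ₑ) (x := y) hNt (hNtop t) (by simpa using hy) (by simp)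
      refine le_trans ?_ (ENNReal.le_tsum j)
      simp only [hG]
      rw [Set.indicator_of_mem (show y ∈ S j t from hj)]

end

/-- Schur test for convolution kernels. -/
lemma schur_conv {k : ℝ → ℝ≥0∞} (hk : Measurable k) {h g : ℝ → ℝ≥0∞} (hh : Measurable h)
    (hg : Measurable g) :
    ∫⁻ s, ∫⁻ t, k |t - s| * (h s * g t) ≤ (∫⁻ u, k |u|) * ((∫⁻ t, h t^2) + ∫⁻ t, g t^2) := by
  have e1 : ∀ s, ∫⁻ t, k |t - s| = ∫⁻ u, k |u| := fun s =>
    lintegral_sub_right_eq_self (fun u => k |u|) s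
  calc _ ≤ ∫⁻ s, ∫⁻ t, (k |t - s| * h s^2 + k |t - s| * g t^2) := by
        apply lintegral_mono; intro s
        apply lintegral_mono; intro t
        simp only
        rw [← mul_add]
        gcongr
        exact mul_le_sq_add_sq _ _
    _ = (∫⁻ s, ∫⁻ t, k |t - s| * h s^2) + ∫⁻ s, ∫⁻ t, k |t - s| * g t^2 := by
        rw [← lintegral_add_left]
        · congr 1; ext s
          rw [lintegral_add_left (by fun_prop)]
        · exact Measurable.lintegral_prod_right' (f := fun z : ℝ × ℝ => k |z.2 - z.1| * h z.1^2)
            (by fun_prop)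
    _ = (∫⁻ s, (∫⁻ u, k |u|) * h s^2) + ∫⁻ t, (∫⁻ u, k |u|) * g t^2 := by
        congr 1
        · congr 1; ext s
          rw [lintegral_mul_const _ (by fun_prop), e1]
        · rw [lintegral_lintegral_swap (by fun_prop)]
          congr 1; ext t
          rw [lintegral_mul_const _ (by fun_prop)]
          simp_rw [abs_sub_comm t]
          rw [e1]
    _ = _ := by
        rw [lintegral_const_mul _ (by fun_prop), lintegral_const_mul _ (by fun_prop), mul_add]

lemma ofReal_two_rpow (x : ℝ) : ENNReal.ofReal ((2:ℝ)^x) = 2^x := by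
  rw [← ENNReal.ofReal_rpow_of_pos (by norm_num)]; norm_num

lemma near_bound {x : ℝ} {h g : ℝ → ℝ≥0∞} (hh : Measurable h) (hg : Measurable g) :
    ∫⁻ s, ∫⁻ t, (Set.Iio ((2:ℝ)^x)).indicator (fun _ => (1:ℝ≥0∞)) |t - s| * (h s * g t) ≤
      2 * 2^x * ((∫⁻ t, h t^2) + ∫⁻ t, g t^2) := by
  refine (schur_conv (measurable_const.indicator measurableSet_Iio) hh hg).trans ?_
  gcongr
  have := lint_near (α := 0) (by norm_num) (δ := (2:ℝ)^x) (by positivity)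
  simpa [ofReal_two_rpow] using this

lemma far_bound {σ : ℝ} (hσ : 1 < σ) {x : ℝ} {h g : ℝ → ℝ≥0∞} (hh : Measurable h) (hg : Measurable g) :
    ∫⁻ s, ∫⁻ t, (Set.Ici ((2:ℝ)^x)).indicator (fun v => (ENNReal.ofReal v)^(-σ)) |t - s| * (h s * g t) ≤
      ENNReal.ofReal (2/(σ-1)) * 2^(x*(1-σ)) * ((∫⁻ t, h t^2) + ∫⁻ t, g t^2) := by
  refine (schur_conv (Measurable.indicator (by fun_prop) measurableSet_Ici) hh hg).trans ?_
  gcongr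
  have := lint_far hσ (δ := (2:ℝ)^x) (by positivity)
  rwa [ofReal_two_rpow, ← ENNReal.rpow_mul] at this

section
variable {H : Type*} [NormedAddCommGroup H] [InnerProductSpace ℂ H]
  [CompleteSpace H]

lemma enorm_inner_int_int {a b : ℝ → H} (ha : Integrable a) (hb : Integrable b) :
    ‖inner ℂ (∫ s, a s) (∫ t, b t)‖ₑ ≤ ∫⁻ s, ∫⁻ t, ‖inner ℂ (a s) (b t)‖ₑ := by
  rw [enorm_inner_symm]
  refine (enorm_inner_integral_le _ ha).trans ?_
  apply lintegral_mono
  intro s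
  simp only
  rw [enorm_inner_symm]
  exact enorm_inner_integral_le _ hb

def cEnd (σ : ℝ) : ℝ≥0∞ := 16 + 8 * ENNReal.ofReal (2/(σ-1))

lemma curve_self {σ : ℝ} (hσ : 1 < σ) {x : ℝ} {a : ℝ → H} {h : ℝ → ℝ≥0∞} (ha : Integrable a)
    (hh : Measurable h) (h1 : ∀ t, ‖a t‖ₑ ≤ 2 * 2^(-x/2) * h t)
    (h2 : ∀ s t, ‖inner ℂ (a s) (a t)‖ₑ ≤ 4 * ker σ s t * 2^(x*(σ-1)) * (h s * h t)) :
    ‖∫ t, a t‖ₑ^2 ≤ cEnd σ * ∫⁻ t, h t^2 := by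
  have e0 : ‖∫ t, a t‖ₑ^2 = ‖inner ℂ (∫ t, a t) (∫ t, a t)‖ₑ := by
    rw [inner_self_eq_norm_sq_to_K, enorm_pow]
    congr 1
    simp [← ofReal_norm]
  rw [e0]
  refine (enorm_inner_int_int ha ha).trans ?_
  have key : ∀ s t, ‖inner ℂ (a s) (a t)‖ₑ ≤
      4 * 2^(-x) * ((Set.Iio ((2:ℝ)^x)).indicator (fun _ => (1:ℝ≥0∞)) |t - s| * (h s * h t)) +
      4 * 2^(x*(σ-1)) * ((Set.Ici ((2:ℝ)^x)).indicator (fun v => (ENNReal.ofReal v)^(-σ)) |t - s| * (h s * h t)) := by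
    intro s t
    by_cases hst : |t - s| < (2:ℝ)^x
    · refine le_add_right ?_
      rw [Set.indicator_of_mem (show |t - s| ∈ Set.Iio ((2:ℝ)^x) from hst)]
      refine (enorm_inner_le _ _).trans ((mul_le_mul' (h1 s) (h1 t)).trans (le_of_eq ?_))
      rw [show -x = -x/2 + -x/2 by ring, two_rpow_add]; ring
    · refine le_add_left ?_
      rw [Set.indicator_of_mem (show |t - s| ∈ Set.Ici ((2:ℝ)^x) from not_lt.mp hst)]
      refine (h2 s t).trans (le_of_eq ?_)
      simp only [ker]; ring
  calc _ ≤ ∫⁻ s, ∫⁻ t, _ := lintegral_mono fun s => lintegral_mono fun t => key s t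
    _ = 4 * 2^(-x) * (∫⁻ s, ∫⁻ t, ((Set.Iio ((2:ℝ)^x)).indicator (fun _ => (1:ℝ≥0∞)) |t - s| * (h s * h t))) +
      4 * 2^(x*(σ-1)) * ∫⁻ s, ∫⁻ t, ((Set.Ici ((2:ℝ)^x)).indicator (fun v => (ENNReal.ofReal v)^(-σ)) |t - s| * (h s * h t)) := by
        have m1 : Measurable ((Set.Iio ((2:ℝ)^x)).indicator (fun _ => (1:ℝ≥0∞))) := measurable_const.indicator measurableSet_Iio
        have m2 : Measurable ((Set.Ici ((2:ℝ)^x)).indicator (fun v => (ENNReal.ofReal v)^(-σ))) := Measurable.indicator (by fun_prop) measurableSet_Ici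
        generalize (Set.Iio ((2:ℝ)^x)).indicator (fun _ => (1:ℝ≥0∞)) = k1 at m1
        generalize (Set.Ici ((2:ℝ)^x)).indicator (fun v => (ENNReal.ofReal v)^(-σ)) = k2 at m2
        have M1 := Measurable.lintegral_prod_right' (ν := volume) (f := fun z : ℝ × ℝ => k1 |z.2 - z.1| * (h z.1 * h z.2)) (by fun_prop)
        have M2 := Measurable.lintegral_prod_right' (ν := volume) (f := fun z : ℝ × ℝ => k2 |z.2 - z.1| * (h z.1 * h z.2)) (by fun_prop)
        rw [← lintegral_const_mul _ M1, ← lintegral_const_mul _ M2, ← lintegral_add_left (M1.const_mul _)]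
        congr 1; ext s
        rw [lintegral_add_left (by fun_prop), lintegral_const_mul _ (by fun_prop), lintegral_const_mul _ (by fun_prop)]
    _ ≤ 4 * 2^(-x) * (2 * 2^x * ((∫⁻ t, h t^2) + ∫⁻ t, h t^2)) +
      4 * 2^(x*(σ-1)) * (ENNReal.ofReal (2/(σ-1)) * 2^(x*(1-σ)) * ((∫⁻ t, h t^2) + ∫⁻ t, h t^2)) := by
        gcongr
        · exact near_bound hh hh
        · exact far_bound hσ hh hh
    _ = (2^(-x) * 2^x) * (16 * ∫⁻ t, h t^2) + (2^(x*(σ-1)) * 2^(x*(1-σ))) * (8 * ENNReal.ofReal (2/(σ-1)) * ∫⁻ t, h t^2) := by ring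
    _ = _ := by
        rw [← two_rpow_add, ← two_rpow_add, show -x + x = 0 by ring, show x*(σ-1)+x*(1-σ) = 0 by ring]
        simp only [cEnd, ENNReal.rpow_zero]
        ring

lemma curve_self_on {σ : ℝ} (hσ : 1 < σ) {x : ℝ} {a : ℝ → H} {h : ℝ → ℝ≥0∞} (ha : Integrable a)
    (hh : Measurable h) (h1 : ∀ t, ‖a t‖ₑ ≤ 2 * 2^(-x/2) * h t)
    (h2 : ∀ s t, ‖inner ℂ (a s) (a t)‖ₑ ≤ 4 * ker σ s t * 2^(x*(σ-1)) * (h s * h t)) {I : Set ℝ}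
    (hI : MeasurableSet I) :
    ‖∫ t in I, a t‖ₑ^2 ≤ cEnd σ * ∫⁻ t, I.indicator (fun _ => 1) t * h t^2 := by
  have := curve_self (a := I.indicator a) (h := I.indicator h) (σ := σ) hσ (x := x) (ha.indicator hI) (hh.indicator hI) ?_ ?_
  · rw [integral_indicator hI] at this
    convert this using 4 with t
    by_cases ht : t ∈ I <;> simp [ht]
  · intro t
    by_cases ht : t ∈ I
    · simpa [ht] using h1 t
    · simp [ht]
  · intro s t
    by_cases ht : t ∈ I
    · by_cases hs : s ∈ I
      · simpa [ht, hs] using h2 s t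
      · simp [hs]
    · simp [ht]

lemma curve_pair {σ : ℝ} (hσ : 1 < σ) {x y : ℝ} {a b : ℝ → H} {h g : ℝ → ℝ≥0∞} (ha : Integrable a)
    (hb : Integrable b) (hh : Measurable h) (hg : Measurable g)
    (h1 : ∀ t, ‖a t‖ₑ ≤ 2 * 2^(-x/2) * h t)
    (h1' : ∀ t, ‖b t‖ₑ ≤ 2 * 2^(-y/2) * g t)
    (h2 : ∀ s t, ‖inner ℂ (a s) (a t)‖ₑ ≤ 4 * ker σ s t * 2^(x*(σ-1)) * (h s * h t))
    (h2' : ∀ s t, ‖inner ℂ (a s) (b t)‖ₑ ≤ 4 * ker σ s t * (2^(x*((σ-1)/2)) * 2^(y*((σ-1)/2))) * (h s * g t)) :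
    ‖inner ℂ (∫ t, a t) (∫ t, b t)‖ₑ ≤
      (2^((x-y)/8) * (4 * cEnd σ + 2) + 2^((x-y)*((σ-1)/4)) * (4 * ENNReal.ofReal (2/(σ-1)))) *
        ((∫⁻ t, h t^2) + ∫⁻ t, g t^2) := by
  set z := (x+3*y)/4 with hz
  set J : ℝ → Set ℝ := fun t => {s | |t - s| < (2:ℝ)^z} with hJ
  have hJm : ∀ t, MeasurableSet (J t) := fun t => measurableSet_lt (by fun_prop) (by fun_prop)
  set k2 : ℝ → ℝ≥0∞ := (Set.Ici ((2:ℝ)^z)).indicator (fun v => (ENNReal.ofReal v)^(-σ)) with hk2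
  have hk2m : Measurable k2 := Measurable.indicator (by fun_prop) measurableSet_Ici
  set k1 : ℝ → ℝ≥0∞ := (Set.Iio ((2:ℝ)^z)).indicator (fun _ => 1) with hk1
  have hk1m : Measurable k1 := measurable_const.indicator measurableSet_Iio
  have hk1i : ∫⁻ u, k1 |u| ≤ 2 * 2^z := by
    have := lint_near (α := 0) (by norm_num) (δ := (2:ℝ)^z) (by positivity)
    simpa [ofReal_two_rpow] using this
  have step : ∀ t, ‖inner ℂ (∫ s, a s) (b t)‖ₑ ≤
      2 * 2^(-y/2) * (2^(-z/2) * (cEnd σ * ∫⁻ s, k1 |t - s| * h s^2) + 2^(z/2) * g t^2) +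
      4 * (2^(x*((σ-1)/2)) * 2^(y*((σ-1)/2))) * ∫⁻ s, k2 |t - s| * (h s * g t) := by
    intro t
    rw [← integral_add_compl (hJm t) ha, inner_add_left]
    refine (enorm_add_le _ _).trans ?_
    gcongr
    · calc _ ≤ ‖∫ s in J t, a s‖ₑ * ‖b t‖ₑ := enorm_inner_le _ _
        _ ≤ ‖∫ s in J t, a s‖ₑ * (2 * 2^(-y/2) * g t) := by gcongr; exact h1' t
        _ = 2 * 2^(-y/2) * ((2^(-z/4) * ‖∫ s in J t, a s‖ₑ) * (2^(z/4) * g t)) := by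
          rw [show (2^(-z/4) * ‖∫ s in J t, a s‖ₑ) * (2^(z/4) * g t) = (2^(-z/4) * 2^(z/4)) * (‖∫ s in J t, a s‖ₑ * g t) by ring,
            ← two_rpow_add, show -z/4 + z/4 = 0 by ring, ENNReal.rpow_zero]; ring
        _ ≤ 2 * 2^(-y/2) * ((2^(-z/4) * ‖∫ s in J t, a s‖ₑ)^2 + (2^(z/4) * g t)^2) := by
          gcongr; exact mul_le_sq_add_sq _ _
        _ = 2 * 2^(-y/2) * (2^(-z/2) * ‖∫ s in J t, a s‖ₑ^2 + 2^(z/2) * g t^2) := by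
          rw [show -z/2 = -z/4 + -z/4 by ring, show z/2 = z/4 + z/4 by ring, two_rpow_add, two_rpow_add]
          ring
        _ ≤ _ := by
          gcongr
          refine (curve_self_on hσ ha hh h1 h2 (hJm t)).trans (le_of_eq ?_)
          congr 2
    · rw [enorm_inner_symm]
      refine (enorm_inner_integral_le _ ha.integrableOn).trans ?_
      rw [← lintegral_indicator (hJm t).compl, ← lintegral_const_mul _ (by fun_prop)]
      apply lintegral_mono
      intro s
      by_cases hs : |t - s| < (2:ℝ)^z
      · rw [Set.indicator_of_notMem (by simpa [hJ] using hs)]; simp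
      · simp only
        rw [Set.indicator_of_mem (show s ∈ (J t)ᶜ from hs), hk2,
          Set.indicator_of_mem (show |t - s| ∈ Set.Ici ((2:ℝ)^z) from not_lt.mp hs), enorm_inner_symm]
        refine (h2' s t).trans (le_of_eq ?_)
        simp only [ker]; ring
  refine (enorm_inner_integral_le _ hb).trans ?_
  have M1 := Measurable.lintegral_prod_right' (ν := volume) (f := fun z : ℝ × ℝ => k1 |z.1 - z.2| * h z.2^2) (by fun_prop)
  have M2 := Measurable.lintegral_prod_right' (ν := volume) (f := fun z : ℝ × ℝ => k2 |z.1 - z.2| * (h z.2 * g z.1)) (by fun_prop)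
  simp only at M1 M2
  have I1 : ∫⁻ t, ∫⁻ s, k1 |t - s| * h s^2 ≤ 2 * 2^z * ∫⁻ s, h s^2 := by
    rw [lintegral_lintegral_swap (by fun_prop)]
    rw [← lintegral_const_mul _ (by fun_prop)]
    apply lintegral_mono; intro s
    simp only
    rw [lintegral_mul_const _ (by fun_prop)]
    gcongr
    rwa [lintegral_sub_right_eq_self (fun u => k1 |u|) s]
  have I2 : ∫⁻ t, ∫⁻ s, k2 |t - s| * (h s * g t) ≤
      ENNReal.ofReal (2/(σ-1)) * 2^(z*(1-σ)) * ((∫⁻ t, h t^2) + ∫⁻ t, g t^2) := by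
    rw [lintegral_lintegral_swap (by fun_prop)]
    exact far_bound hσ hh hg
  calc _ ≤ _ := lintegral_mono step
    _ = 2 * 2^(-y/2) * (2^(-z/2) * (cEnd σ * ∫⁻ t, ∫⁻ s, k1 |t - s| * h s^2) + 2^(z/2) * ∫⁻ t, g t^2) +
      4 * (2^(x*((σ-1)/2)) * 2^(y*((σ-1)/2))) * ∫⁻ t, ∫⁻ s, k2 |t - s| * (h s * g t) := by
        rw [lintegral_add_left (by fun_prop), lintegral_const_mul _ (by fun_prop), lintegral_const_mul _ (by fun_prop),
          lintegral_add_left (by fun_prop), lintegral_const_mul _ (by fun_prop), lintegral_const_mul _ (by fun_prop),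
          lintegral_const_mul _ (by fun_prop)]
    _ ≤ 2 * 2^(-y/2) * (2^(-z/2) * (cEnd σ * (2 * 2^z * ∫⁻ s, h s^2)) + 2^(z/2) * ∫⁻ t, g t^2) +
      4 * (2^(x*((σ-1)/2)) * 2^(y*((σ-1)/2))) * (ENNReal.ofReal (2/(σ-1)) * 2^(z*(1-σ)) * ((∫⁻ t, h t^2) + ∫⁻ t, g t^2)) := by
        gcongr
    _ = 2^((x-y)/8) * (4 * cEnd σ * (∫⁻ s, h s^2) + 2 * ∫⁻ t, g t^2) +
      2^((x-y)*((σ-1)/4)) * (4 * ENNReal.ofReal (2/(σ-1))) * ((∫⁻ t, h t^2) + ∫⁻ t, g t^2) := by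
        rw [show 2 * 2^(-y/2) * (2^(-z/2) * (cEnd σ * (2 * 2^z * ∫⁻ s, h s^2)) + 2^(z/2) * ∫⁻ t, g t^2) =
          (2^(-y/2) * 2^(-z/2) * 2^z) * (4 * cEnd σ * ∫⁻ s, h s^2) + (2^(-y/2) * 2^(z/2)) * (2 * ∫⁻ t, g t^2) by ring]
        rw [show 4 * (2^(x*((σ-1)/2)) * 2^(y*((σ-1)/2))) * (ENNReal.ofReal (2/(σ-1)) * 2^(z*(1-σ)) * ((∫⁻ t, h t^2) + ∫⁻ t, g t^2))
          = (2^(x*((σ-1)/2)) * 2^(y*((σ-1)/2)) * 2^(z*(1-σ))) * (4 * ENNReal.ofReal (2/(σ-1))) * ((∫⁻ t, h t^2) + ∫⁻ t, g t^2) by ring]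
        rw [← two_rpow_add, ← two_rpow_add, ← two_rpow_add, ← two_rpow_add, ← two_rpow_add,
          show -y/2 + -z/2 + z = (x-y)/8 by rw [hz]; ring, show -y/2+z/2 = (x-y)/8 by rw [hz]; ring,
          show x * ((σ-1)/2) + y*((σ-1)/2) + z*(1-σ) = (x-y)*((σ-1)/4) by rw [hz]; ring]
        ring
    _ ≤ 2^((x-y)/8) * (4 * cEnd σ * ((∫⁻ s, h s^2) + ∫⁻ t, g t^2) + 2 * ((∫⁻ s, h s^2) + ∫⁻ t, g t^2)) +
      2^((x-y)*((σ-1)/4)) * (4 * ENNReal.ofReal (2/(σ-1))) * ((∫⁻ t, h t^2) + ∫⁻ t, g t^2) := by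
        gcongr
        · exact le_self_add
        · exact le_add_self
    _ = _ := by ring

end

/-- The dual estimate. -/
def DualBound {X H : Type*} [MeasurableSpace X] [NormedAddCommGroup H] [InnerProductSpace ℂ H]
    (ν : Measure X) (Φ : ℝ → X → H) (p b : ℝ) (C : ℝ≥0∞) : Prop :=
  ∀ (F : ℝ → X → ℂ) (N : ℝ → ℝ≥0∞) (w : H), Measurable (fun z : ℝ × X => F z.1 z.2) → Measurable N →
    (∀ t, N t ≠ ⊤) → (∀ t, ∫⁻ x, ‖F t x‖ₑ^p ∂ν ≤ N t^p) → (∫⁻ t, N t ≠ ⊤) →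
    (∀ t x, F t x * inner ℂ w (Φ t x) = ((‖F t x‖ * ‖inner ℂ w (Φ t x)‖ : ℝ) : ℂ)) →
    ∫⁻ t, ∫⁻ x, ‖F t x‖ₑ * ‖inner ℂ w (Φ t x)‖ₑ ∂ν ≤ ‖w‖ₑ * (C * (∫⁻ t, N t^b)^(1/b))

set_option linter.unusedSectionVars false
section
variable {H : Type*} [NormedAddCommGroup H] [InnerProductSpace ℂ H]
  [CompleteSpace H]

lemma enorm_sum_sq_le (s : Finset ℤ) (V : ℤ → H) :
    ‖∑ j ∈ s, V j‖ₑ^2 ≤ ∑' j, ∑' l, ‖inner ℂ (V j) (V l)‖ₑ := by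
  have e0 : ‖∑ j ∈ s, V j‖ₑ^2 = ‖inner ℂ (∑ j ∈ s, V j) (∑ j ∈ s, V j)‖ₑ := by
    rw [inner_self_eq_norm_sq_to_K, enorm_pow]
    congr 1
    simp [← ofReal_norm]
  rw [e0, sum_inner]
  calc _ ≤ ∑ j ∈ s, ‖inner ℂ (V j) (∑ l ∈ s, V l)‖ₑ := enorm_sum_le _ _
    _ ≤ ∑ j ∈ s, ∑ l ∈ s, ‖inner ℂ (V j) (V l)‖ₑ := by
        gcongr with j
        rw [inner_sum]
        exact enorm_sum_le _ _
    _ ≤ ∑ j ∈ s, ∑' l, ‖inner ℂ (V j) (V l)‖ₑ := by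
        gcongr with j
        exact ENNReal.sum_le_tsum _
    _ ≤ _ := ENNReal.sum_le_tsum _

lemma sqrt_bound {a C b : ℝ≥0∞} (h : a^2 ≤ C * b) : a ≤ C^(1/2:ℝ) * b^(1/2:ℝ) := by
  rw [← ENNReal.mul_rpow_of_nonneg _ _ (by norm_num)]
  calc a = (a^2)^(1/2:ℝ) := by
        rw [← ENNReal.rpow_natCast, ← ENNReal.rpow_mul]; norm_num
    _ ≤ _ := by gcongr

def cE (σ : ℝ) : ℝ≥0∞ := 4 * cEnd σ + 2 + 4 * ENNReal.ofReal (2/(σ-1))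
def eE (σ : ℝ) : ℝ := min (1/(8*σ)) ((σ-1)/(4*σ))
def CE (σ : ℝ) : ℝ≥0∞ := (cE σ * geoSum (eE σ) * 2)^(1/2:ℝ)

lemma CE_ne_top {σ : ℝ} (hσ : 1 < σ) : CE σ ≠ ⊤ := by
  have h1 : 0 < eE σ := by
    unfold eE
    have : 0 < σ - 1 := by linarith
    have : 0 < σ := by linarith
    positivity
  have := geoSum_ne_top h1
  have : cE σ ≠ ⊤ := by unfold cE cEnd; finiteness
  unfold CE
  finiteness

lemma end_pair {σ : ℝ} (hσ : 1 < σ) {i j : ℤ} (hij : j ≤ i) {a b : ℝ → H} {h g : ℝ → ℝ≥0∞} (ha : Integrable a)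
    (hb : Integrable b) (hh : Measurable h) (hg : Measurable g)
    (h1 : ∀ t, ‖a t‖ₑ ≤ 2 * 2^((i:ℝ)/(2*σ)) * h t)
    (h1' : ∀ t, ‖b t‖ₑ ≤ 2 * 2^((j:ℝ)/(2*σ)) * g t)
    (h2 : ∀ s t, ‖inner ℂ (a s) (a t)‖ₑ ≤ 4 * ker σ s t * (2^((i:ℝ)*(1/(2*σ)-1/2)) * 2^((i:ℝ)*(1/(2*σ)-1/2))) * (h s * h t))
    (h2' : ∀ s t, ‖inner ℂ (a s) (b t)‖ₑ ≤ 4 * ker σ s t * (2^((i:ℝ)*(1/(2*σ)-1/2)) * 2^((j:ℝ)*(1/(2*σ)-1/2))) * (h s * g t)) :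
    ‖inner ℂ (∫ t, a t) (∫ t, b t)‖ₑ ≤
      cE σ * 2^(-(eE σ * |((i-j : ℤ):ℝ)|)) * ((∫⁻ t, h t^2) + ∫⁻ t, g t^2) := by
  have hσ0 : σ ≠ 0 := by linarith
  have hσp : 0 < σ := by linarith
  have := curve_pair hσ (x := -(i:ℝ)/σ) (y := -(j:ℝ)/σ) ha hb hh hg ?_ ?_ ?_ ?_
  · refine this.trans ?_
    gcongr
    have hji : (j:ℝ) ≤ i := by exact_mod_cast hij
    have ea : |((i-j : ℤ):ℝ)| = (i:ℝ) - j := by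
      push_cast; rw [abs_of_nonneg]; linarith
    have e1 : (2:ℝ≥0∞)^((-(i:ℝ)/σ - -(j:ℝ)/σ)/8) ≤ 2^(-(eE σ * |((i-j : ℤ):ℝ)|)) := by
      apply two_rpow_mono
      rw [ea, show (-(i:ℝ)/σ - -(j:ℝ)/σ)/8 = -(1/(8*σ) * ((i:ℝ)-j)) by field_simp; ring]
      apply neg_le_neg
      exact mul_le_mul_of_nonneg_right (min_le_left _ _) (by linarith)
    have e2 : (2:ℝ≥0∞)^((-(i:ℝ)/σ - -(j:ℝ)/σ)*((σ-1)/4)) ≤ 2^(-(eE σ * |((i-j : ℤ):ℝ)|)) := by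
      apply two_rpow_mono
      rw [ea, show (-(i:ℝ)/σ - -(j:ℝ)/σ)*((σ-1)/4) = -((σ-1)/(4*σ) * ((i:ℝ)-j)) by field_simp; ring]
      apply neg_le_neg
      exact mul_le_mul_of_nonneg_right (min_le_right _ _) (by linarith)
    calc _ ≤ 2^(-(eE σ * |((i-j : ℤ):ℝ)|)) * (4 * cEnd σ + 2) + 2^(-(eE σ * |((i-j : ℤ):ℝ)|)) * (4 * ENNReal.ofReal (2/(σ-1))) := by gcongr
      _ = _ := by unfold cE; ring
  · intro t
    convert h1 t using 4; field_simp
  · intro t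
    convert h1' t using 4; field_simp
  · intro s t
    convert h2 s t using 2
    rw [← two_rpow_add]; congr 2; field_simp; ring
  · intro s t
    convert h2' s t using 4
    · congr 1; field_simp; ring
    · congr 1; field_simp; ring

variable {X : Type*} [MeasurableSpace X] {ν : Measure X} [SFinite ν] {σ : ℝ} {Φ : ℝ → X → H}

lemma Disp.endpoint (h : Disp ν σ Φ) (hσ : 1 < σ) : DualBound ν Φ (2*σ/(σ+1)) 2 (CE σ) := by
  intro F N w hF hN hNtop hFN hNint hw
  have hσp : 0 < σ := by linarith
  have hp1 : 1 ≤ 2*σ/(σ+1) := by rw [le_div_iff₀ (by linarith)]; linarith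
  have ip : 1/(2*σ/(σ+1)) = 1/2 + 1/(2*σ) := by field_simp
  obtain ⟨a, g, ha, hg, hgs, h1, h2, hfin⟩ := h.atoms hp1 hF hN hNtop hFN hNint
  refine hfin w _ hw ?_
  intro s
  have e2 : (∫⁻ t, N t^(2:ℝ)) = ∫⁻ t, N t^2 := by norm_cast
  rw [e2]
  apply sqrt_bound
  refine (enorm_sum_sq_le _ _).trans ?_
  set x : ℤ → ℝ≥0∞ := fun j => ∫⁻ t, (N t * g j t)^2 with hx
  have key : ∀ i j, j ≤ i → ‖inner ℂ (∫ t, a i t) (∫ t, a j t)‖ₑ ≤ cE σ * 2^(-(eE σ * |((i-j : ℤ):ℝ)|)) * (x i + x j) := by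
    intro i j hij
    apply end_pair hσ hij (h := fun t => N t * g i t) (g := fun t => N t * g j t) (ha i) (ha j) (hN.mul (hg i)) (hN.mul (hg j))
    · intro t; convert h1 i t using 4; rw [ip]; ring
    · intro t; convert h1 j t using 4; rw [ip]; ring
    · intro s t; convert h2 i i s t using 6 <;> rw [ip] <;> ring
    · intro s t; convert h2 i j s t using 6 <;> rw [ip] <;> ring
  have key2 : ∀ i j, ‖inner ℂ (∫ t, a i t) (∫ t, a j t)‖ₑ ≤ cE σ * 2^(-(eE σ * |((i-j : ℤ):ℝ)|)) * (x i + x j) := by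
    intro i j
    rcases le_total j i with hij | hij
    · exact key i j hij
    · rw [enorm_inner_symm, add_comm (x i)]
      convert key j i hij using 6
      push_cast
      rw [abs_sub_comm]
  have hxs : ∑' j, x j ≤ ∫⁻ t, N t^2 := by
    rw [hx, ← lintegral_tsum (fun j => by have := hg j; fun_prop)]
    apply lintegral_mono; intro t
    simp only [mul_pow]
    rw [ENNReal.tsum_mul_left]
    calc _ ≤ N t^2 * 1 := by gcongr; exact hgs t
      _ = _ := mul_one _
  calc _ ≤ ∑' i, ∑' j, cE σ * 2^(-(eE σ * |((i-j : ℤ):ℝ)|)) * (x i + x j) :=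
        ENNReal.tsum_le_tsum fun i => ENNReal.tsum_le_tsum fun j => key2 i j
    _ = (∑' i : ℤ, cE σ * 2^(-(eE σ * |(i:ℝ)|))) * (∑' i, x i + ∑' j, x j) :=
        schur_diff (fun i => cE σ * 2^(-(eE σ * |(i:ℝ)|))) x x
    _ = cE σ * geoSum (eE σ) * (∑' i, x i + ∑' j, x j) := by rw [ENNReal.tsum_mul_left, geoSum]
    _ ≤ cE σ * geoSum (eE σ) * ((∫⁻ t, N t^2) + ∫⁻ t, N t^2) := by gcongr
    _ = _ := by ring

end

def kmin (a b : ℝ) (D : ℝ≥0∞) (m : ℤ) : ℝ≥0∞ := min (2^((m:ℝ)*a)) (D * 2^(-((m:ℝ)*b)))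

lemma geo_shift {c : ℝ} (hc : 0 < c) (y : ℝ) :
    ∑' m : ℤ, (2:ℝ≥0∞)^(-(c*|(m:ℝ)-y|)) ≤ 2^c * geoSum c := by
  have e : geoSum c = ∑' m : ℤ, (2:ℝ≥0∞)^(-(c*|((m - ⌊y⌋ : ℤ):ℝ)|)) :=
    ((Equiv.subRight ⌊y⌋).tsum_eq (fun i : ℤ => (2:ℝ≥0∞)^(-(c*|(i:ℝ)|)))).symm
  rw [e, ← ENNReal.tsum_mul_left]
  apply ENNReal.tsum_le_tsum
  intro m
  rw [← two_rpow_add]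
  apply two_rpow_mono
  have h1 : |((m - ⌊y⌋ : ℤ):ℝ)| ≤ |(m:ℝ)-y| + 1 := by
    push_cast
    calc |(m:ℝ) - ⌊y⌋| = |((m:ℝ) - y) + (y - ⌊y⌋)| := by ring_nf
      _ ≤ |(m:ℝ) - y| + |y - ⌊y⌋| := abs_add_le _ _
      _ ≤ _ := by
        have h2 := Int.floor_le y
        have h3 := (Int.lt_floor_add_one y).le
        have : |y - ⌊y⌋| ≤ 1 := by rw [abs_of_nonneg] <;> linarith
        linarith
  nlinarith

lemma kmin_sum {a b : ℝ} (ha : 0 < a) (hb : 0 < b) (hab : a + b = 1/2) (D : ℝ≥0∞) :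
    ∑' m, kmin a b D m ≤ (2^(min a b) * geoSum (min a b)) * D^(2*a) := by
  have hc : 0 < min a b := lt_min ha hb
  rcases eq_or_ne D ⊤ with rfl | hD
  · rw [ENNReal.top_rpow_of_pos (by linarith), ENNReal.mul_top]
    · exact le_top
    · refine mul_ne_zero (two_rpow_ne_zero _) ?_
      unfold geoSum
      intro h0
      rw [ENNReal.tsum_eq_zero] at h0
      exact two_rpow_ne_zero _ (h0 0)
  rcases eq_or_ne D 0 with rfl | hD0
  · simp [kmin]
  obtain ⟨x, rfl⟩ : ∃ x : ℝ, D = 2^x := by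
    refine ⟨Real.logb 2 D.toReal, ?_⟩
    rw [← ofReal_two_rpow, Real.rpow_logb (by norm_num) (by norm_num) (ENNReal.toReal_pos hD0 hD), ENNReal.ofReal_toReal hD]
  rw [← ENNReal.rpow_mul]
  calc _ ≤ ∑' m : ℤ, 2^(x*(2*a)) * (2:ℝ≥0∞)^(-(min a b*|(m:ℝ)-2*x|)) := by
        apply ENNReal.tsum_le_tsum
        intro m
        unfold kmin
        rw [← two_rpow_add, ← two_rpow_add]
        rcases le_total (m:ℝ) (2*x) with h | h
        · refine (min_le_left _ _).trans (two_rpow_mono ?_)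
          rw [abs_of_nonpos (by linarith)]
          nlinarith [min_le_left a b]
        · refine (min_le_right _ _).trans (two_rpow_mono ?_)
          rw [abs_of_nonneg (by linarith)]
          have hb' : a = 1/2 - b := by linarith
          have := mul_le_mul_of_nonneg_right (min_le_right a b) (show 0 ≤ (m:ℝ) - 2*x by linarith)
          have e : x * (2*a) = x - 2*x*b := by rw [hb']; ring
          rw [e]; nlinarith
    _ = 2^(x*(2*a)) * ∑' m : ℤ, (2:ℝ≥0∞)^(-(min a b*|(m:ℝ)-2*x|)) := ENNReal.tsum_mul_left
    _ ≤ 2^(x*(2*a)) * (2^(min a b) * geoSum (min a b)) := by gcongr; exact geo_shift hc _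
    _ = _ := mul_comm _ _

lemma tsum_swap (B : ℤ → ℤ → ℝ → ℝ → ℝ≥0∞)
    (hBm : ∀ j l, Measurable (fun z : ℝ × ℝ => B j l z.1 z.2)) :
    ∑' j, ∑' l, ∫⁻ s, ∫⁻ t, B j l s t = ∫⁻ s, ∫⁻ t, ∑' j, ∑' l, B j l s t := by
  have m1 : ∀ j l s, Measurable (fun t => B j l s t) := fun j l s =>
    (hBm j l).comp (by fun_prop : Measurable (fun t : ℝ => (s, t)))
  have m2 : ∀ j l, Measurable (fun s => ∫⁻ t, B j l s t) := fun j l =>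
    Measurable.lintegral_prod_right' (hBm j l)
  calc _ = ∑' j, ∫⁻ s, ∑' l, ∫⁻ t, B j l s t := by
        congr 1; ext j
        rw [lintegral_tsum (fun l => (m2 j l).aemeasurable)]
    _ = ∫⁻ s, ∑' j, ∑' l, ∫⁻ t, B j l s t :=
        (lintegral_tsum (fun j => (Measurable.tsum (fun l => m2 j l)).aemeasurable)).symm
    _ = ∫⁻ s, ∑' j, ∫⁻ t, ∑' l, B j l s t := by
        congr 1; ext s; congr 1; ext j
        rw [lintegral_tsum (fun l => (m1 j l s).aemeasurable)]
    _ = _ := by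
        congr 1; ext s
        rw [lintegral_tsum (fun j => (Measurable.tsum (fun l => m1 j l s)).aemeasurable)]

set_option linter.unusedSectionVars false
section
variable {H : Type*} [NormedAddCommGroup H] [InnerProductSpace ℂ H]
  [CompleteSpace H]
variable {X : Type*} [MeasurableSpace X] {ν : Measure X} [SFinite ν]

lemma Disp.nonend {σ θ : ℝ} (hσ : 0 < σ) (hθ : 1/2 < θ) (hθ1 : θ < 1) (hα : σ*(2*θ-1) < 1) :
    ∃ C : ℝ≥0∞, C ≠ ⊤ ∧ ∀ Φ : ℝ → X → H, Disp ν σ Φ → DualBound ν Φ (1/θ) (2/(2-σ*(2*θ-1))) C := by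
  have hα0 : 0 < σ*(2*θ-1) := mul_pos hσ (by linarith)
  obtain ⟨C, hC, -, hls⟩ := hls hα0 hα
  set α := σ*(2*θ-1) with hαdef
  set a' := θ - 1/2 with ha'
  set b' := 1 - θ with hb'
  have ha0 : 0 < a' := by rw [ha']; linarith
  have hb0 : 0 < b' := by rw [hb']; linarith
  set Cg := (2:ℝ≥0∞)^(min a' b') * geoSum (min a' b') with hCg
  have hCgt : Cg ≠ ⊤ := ENNReal.mul_ne_top (two_rpow_ne_top _) (geoSum_ne_top (lt_min ha0 hb0))
  refine ⟨(8 * Cg * C)^(1/2:ℝ), by finiteness, ?_⟩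
  intro Φ h F N w hF hN hNtop hFN hNint hw
  obtain ⟨a, g, ha, hg, hgs, h1, h2, hfin⟩ := h.atoms (p := 1/θ)
    (by rw [le_div_iff₀ (by linarith)]; linarith) hF hN hNtop hFN hNint
  refine hfin w _ hw ?_
  intro s
  have e3 : (∫⁻ t, N t^(2/(2-α)))^(1/(2/(2-α))) = ((∫⁻ t, N t^(2/(2-α)))^(2-α))^(1/2:ℝ) := by
    rw [← ENNReal.rpow_mul]; congr 1; field_simp
  rw [e3]
  apply sqrt_bound
  refine (enorm_sum_sq_le _ _).trans ?_
  set B : ℤ → ℤ → ℝ → ℝ → ℝ≥0∞ := fun j l s t =>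
    kmin a' b' (ker σ s t) (j+l) * (g j s^2 + g l t^2) * (4 * (N s * N t)) with hB
  have hBm : ∀ j l, Measurable (fun z : ℝ × ℝ => B j l z.1 z.2) := by
    intro j l
    have := hg j
    have := hg l
    simp only [hB, kmin]
    fun_prop
  have key : ∀ j l s t, ‖inner ℂ (a j s) (a l t)‖ₑ ≤ B j l s t := by
    intro j l s t
    have A1 : ‖inner ℂ (a j s) (a l t)‖ₑ ≤ 2^(((j+l:ℤ):ℝ)*a') * (4 * (N s * N t) * (g j s * g l t)) := by
      refine (enorm_inner_le _ _).trans ((mul_le_mul' (h1 j s) (h1 l t)).trans (le_of_eq ?_))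
      rw [show ((j+l:ℤ):ℝ)*a' = (j:ℝ)*a' + (l:ℝ)*a' by push_cast; ring, two_rpow_add, ha', one_div_one_div]
      ring
    have A2 : ‖inner ℂ (a j s) (a l t)‖ₑ ≤ ker σ s t * 2^(-(((j+l:ℤ):ℝ)*b')) * (4 * (N s * N t) * (g j s * g l t)) := by
      refine (h2 j l s t).trans (le_of_eq ?_)
      rw [show -(((j+l:ℤ):ℝ)*b') = (j:ℝ)*(θ-1) + (l:ℝ)*(θ-1) by rw [hb']; push_cast; ring, two_rpow_add, one_div_one_div]
      ring
    calc _ ≤ kmin a' b' (ker σ s t) (j+l) * (4 * (N s * N t) * (g j s * g l t)) := by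
          unfold kmin
          rcases min_choice ((2:ℝ≥0∞)^(((j+l:ℤ):ℝ)*a')) (ker σ s t * 2^(-(((j+l:ℤ):ℝ)*b'))) with e | e <;> rw [e] <;> assumption
      _ ≤ kmin a' b' (ker σ s t) (j+l) * (4 * (N s * N t) * (g j s^2 + g l t^2)) := by
          gcongr; exact mul_le_sq_add_sq _ _
      _ = _ := by simp only [hB]; ring
  calc _ ≤ ∑' j, ∑' l, ∫⁻ s, ∫⁻ t, B j l s t := by
        refine ENNReal.tsum_le_tsum fun j => ENNReal.tsum_le_tsum fun l => ?_
        refine (enorm_inner_int_int (ha j) (ha l)).trans ?_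
        exact lintegral_mono fun s => lintegral_mono fun t => key j l s t
    _ = ∫⁻ s, ∫⁻ t, ∑' j, ∑' l, B j l s t := tsum_swap B hBm
    _ ≤ ∫⁻ s, ∫⁻ t, (8 * Cg) * (ker α s t * (N s * N t)) := by
        refine lintegral_mono fun s => lintegral_mono fun t => ?_
        simp only [hB]
        simp_rw [ENNReal.tsum_mul_right]
        rw [schur_hankel (fun m => kmin a' b' (ker σ s t) m) (fun j => g j s^2) (fun l => g l t^2)]
        have e4 : ker σ s t^(2*a') = ker α s t := by
          simp only [ker]; rw [← ENNReal.rpow_mul]; congr 1; rw [ha', hαdef]; ring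
        calc _ ≤ (Cg * ker σ s t^(2*a')) * (1 + 1) * (4 * (N s * N t)) := by
              gcongr
              · exact kmin_sum ha0 hb0 (by rw [ha', hb']; ring) _
              · exact hgs s
              · exact hgs t
          _ = _ := by rw [e4]; ring
    _ = (8 * Cg) * ∫⁻ s, ∫⁻ t, (ker α s t * (N s * N t)) := by
        rw [← lintegral_const_mul']
        · congr 1; ext s
          rw [lintegral_const_mul' _ _ (by finiteness)]
        · finiteness
    _ ≤ (8 * Cg) * (C * (∫⁻ t, N t^(2/(2-α)))^(2-α)) := by gcongr; exact hls N hN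
    _ = _ := by ring

end

lemma absorb {J A : ℝ≥0∞} {q b : ℝ} (hq : 1 < q) (hb : 1/b + 1/q = 1) (hJ : J ≠ ⊤)
    (h : J ≤ A * J^(1/b)) : J ≤ A^q := by
  rcases eq_or_ne J 0 with rfl | hJ0
  · simp
  have h1 : J^(1/q) ≤ A := by
    have e : J = J^(1/q) * J^(1/b) := by
      rw [← ENNReal.rpow_add _ _ hJ0 hJ, add_comm, hb, ENNReal.rpow_one]
    have hb0 : J^(1/b) ≠ 0 := by
      simp [ENNReal.rpow_eq_zero_iff, hJ0, hJ]
    have hbt : J^(1/b) ≠ ⊤ := by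
      simp [ENNReal.rpow_eq_top_iff, hJ0, hJ]
    rw [e] at h
    have h' : J^(1/q) * J^(1/b) ≤ A * J^(1/b) := by
      calc _ ≤ A * (J^(1/q) * J^(1/b))^(1/b) := h
        _ = _ := by rw [← e]
    exact (ENNReal.mul_le_mul_iff_left hb0 hbt).mp h'
  calc J = (J^(1/q))^q := by rw [← ENNReal.rpow_mul, one_div_mul_cancel (by linarith), ENNReal.rpow_one]
    _ ≤ _ := by gcongr

set_option linter.unusedSectionVars false
section
variable {H : Type*} [NormedAddCommGroup H] [InnerProductSpace ℂ H]
  [CompleteSpace H]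
variable {X : Type*} [MeasurableSpace X] {ν : Measure X} [SFinite ν]

lemma enorm_rpow_of_real {x y : ℝ} (hx : 0 ≤ x) (hy : 0 ≤ y) : ENNReal.ofReal (x^y) = (ENNReal.ofReal x)^y :=
  (ENNReal.ofReal_rpow_of_nonneg hx hy).symm

lemma dual_step {Φ : ℝ → X → H} {p b q r : ℝ} {C : ℝ≥0∞} (hD : DualBound ν Φ p b C)
    (hm : StronglyMeasurable (fun z : ℝ × X => Φ z.1 z.2)) {B : ℝ} (hB : ∀ t x, ‖Φ t x‖ ≤ B)
    (hq : 2 ≤ q) (hr : 2 ≤ r) (hb : 1/b + 1/q = 1) (hp : 1/p + 1/r = 1) (w : H)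
    {T : Set ℝ} {S : Set X} (hT : MeasurableSet T) (hS : MeasurableSet S) (hTf : volume T ≠ ⊤)
    (hSf : ν S ≠ ⊤) :
    ∫⁻ t in T, (∫⁻ x in S, ‖inner ℂ w (Φ t x)‖ₑ^r ∂ν)^(q/r) ≤ (‖w‖ₑ * C)^q := by
  have hp0 : 0 < p := by
    by_contra hcon
    have h1 : 1/p ≤ 0 := one_div_nonpos.mpr (not_lt.mp hcon)
    have h2 : 1/r ≤ 1/2 := by gcongr
    linarith
  have hb0 : 0 < b := by
    by_contra hcon
    have h1 : 1/b ≤ 0 := one_div_nonpos.mpr (not_lt.mp hcon)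
    have h2 : 1/q ≤ 1/2 := by gcongr
    linarith
  have hpr : (r-1)*p = r := by field_simp at hp; linarith
  have hqb : (q-1)*b = q := by field_simp at hb; linarith
  set v : ℝ → X → ℂ := fun t x => inner ℂ w (Φ t x) with hv
  have hvm : Measurable (fun z : ℝ × X => v z.1 z.2) :=
    (StronglyMeasurable.inner stronglyMeasurable_const hm).measurable
  have hvt : ∀ t, Measurable (v t) := fun t =>
    hvm.comp (by fun_prop : Measurable (fun x : X => (t, x)))
  have hvB : ∀ t x, ‖v t x‖ₑ ≤ ENNReal.ofReal (‖w‖ * B) := by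
    intro t x
    rw [← ofReal_norm]
    apply ENNReal.ofReal_le_ofReal
    refine (norm_inner_le_norm _ _).trans ?_
    gcongr
    exact hB t x
  set m : ℝ → ℝ≥0∞ := fun t => ∫⁻ x in S, ‖v t x‖ₑ^r ∂ν with hmdef
  have hmm : Measurable m := Measurable.lintegral_prod_right' (f := fun z : ℝ × X => ‖v z.1 z.2‖ₑ^r) (by fun_prop)
  set Mb := (ENNReal.ofReal (‖w‖ * B))^r * ν S with hMb
  have hMbt : Mb ≠ ⊤ := ENNReal.mul_ne_top (ENNReal.rpow_ne_top_of_nonneg (by linarith) (by finiteness)) hSf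
  have hmb : ∀ t, m t ≤ Mb := by
    intro t
    calc m t ≤ ∫⁻ x in S, (ENNReal.ofReal (‖w‖ * B))^r ∂ν := by
          apply lintegral_mono; intro x
          simp only
          gcongr
          exact hvB t x
      _ = _ := by simp [hMb]
  have hmt : ∀ t, m t ≠ ⊤ := fun t => ((hmb t).trans_lt hMbt.lt_top).ne
  set n : ℝ → ℝ≥0∞ := fun t => (m t)^(1/r) with hn
  have hnm : Measurable n := hmm.pow_const _
  have hnt : ∀ t, n t ≠ ⊤ := fun t => ENNReal.rpow_ne_top_of_nonneg (by positivity) (hmt t)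
  have hnr : ∀ t, m t = n t^r := by
    intro t
    simp only [hn]
    rw [← ENNReal.rpow_mul, one_div_mul_cancel (by linarith), ENNReal.rpow_one]
  set c : ℝ → X → ℝ := fun t x => T.indicator (fun _ => (1:ℝ)) t * (S.indicator (fun _ => (1:ℝ)) x *
    (‖v t x‖^(r-2) * (n t).toReal^(q-r))) with hc
  have hc0 : ∀ t x, 0 ≤ c t x := by
    intro t x
    refine mul_nonneg (Set.indicator_nonneg (fun _ _ => zero_le_one) _) (mul_nonneg (Set.indicator_nonneg (fun _ _ => zero_le_one) _) (by positivity))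
  have hcm : Measurable (fun z : ℝ × X => c z.1 z.2) := by
    have m1 : Measurable (T.indicator (fun _ => (1:ℝ))) := measurable_const.indicator hT
    have m2 : Measurable (S.indicator (fun _ => (1:ℝ))) := measurable_const.indicator hS
    simp only [hc]
    fun_prop
  set F : ℝ → X → ℂ := fun t x => (c t x : ℂ) * (starRingEnd ℂ) (v t x) with hF
  have hFm : Measurable (fun z : ℝ × X => F z.1 z.2) := by
    simp only [hF]
    exact (Complex.measurable_ofReal.comp hcm).mul (Complex.continuous_conj.measurable.comp hvm)
  have hFn : ∀ t x, ‖F t x‖ = c t x * ‖v t x‖ := by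
    intro t x
    simp only [hF]
    rw [norm_mul, Complex.norm_real, Real.norm_of_nonneg (hc0 t x), RCLike.norm_conj]
  have hFe : ∀ t x, ‖F t x‖ₑ = T.indicator (fun _ => 1) t * (S.indicator (fun _ => 1) x *
      (‖v t x‖ₑ^(r-1) * ENNReal.ofReal ((n t).toReal^(q-r)))) := by
    intro t x
    rw [← ofReal_norm, hFn]
    simp only [hc]
    by_cases ht : t ∈ T
    · by_cases hx : x ∈ S
      · simp only [Set.indicator_of_mem ht, Set.indicator_of_mem hx, one_mul]
        rw [mul_right_comm, ENNReal.ofReal_mul (by positivity)]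
        congr 1
        rw [← ofReal_norm, ← enorm_rpow_of_real (norm_nonneg _) (by linarith)]
        congr 1
        rcases eq_or_ne (v t x) 0 with h0 | h0
        · rw [h0]; simp [Real.zero_rpow (show r - 1 ≠ 0 by linarith)]
        · rw [show r - 1 = (r-2) + 1 by ring, Real.rpow_add_one (by simpa using h0)]
      · simp [hx]
    · simp [ht]
  set N : ℝ → ℝ≥0∞ := fun t => T.indicator (fun _ => 1) t * n t^(q-1) with hN
  have mT : Measurable (T.indicator (fun _ => (1:ℝ≥0∞))) := measurable_const.indicator hT
  have mS : Measurable (S.indicator (fun _ => (1:ℝ≥0∞))) := measurable_const.indicator hS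
  have hT01 : ∀ t (y : ℝ), 0 < y → (T.indicator (fun _ => (1:ℝ≥0∞)) t)^y = T.indicator (fun _ => (1:ℝ≥0∞)) t := by
    intro t y hy
    by_cases ht : t ∈ T <;> simp [ht, hy]
  have hS01 : ∀ t (y : ℝ), 0 < y → (S.indicator (fun _ => (1:ℝ≥0∞)) t)^y = S.indicator (fun _ => (1:ℝ≥0∞)) t := by
    intro t y hy
    by_cases ht : t ∈ S <;> simp [ht, hy]
  have hSint : ∀ (f : X → ℝ≥0∞), ∫⁻ x, S.indicator (fun _ => 1) x * f x ∂ν = ∫⁻ x in S, f x ∂ν := by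
    intro f
    rw [← lintegral_indicator hS]
    congr 1; ext x
    by_cases hx : x ∈ S <;> simp [hx]
  have hTint : ∀ (f : ℝ → ℝ≥0∞), ∫⁻ t, T.indicator (fun _ => 1) t * f t = ∫⁻ t in T, f t := by
    intro f
    rw [← lintegral_indicator hT]
    congr 1; ext x
    by_cases hx : x ∈ T <;> simp [hx]
  have hnn : ∀ t, n t ≠ 0 → ENNReal.ofReal ((n t).toReal^(q-r)) = n t^(q-r) := by
    intro t h0
    rw [← ENNReal.ofReal_rpow_of_pos (ENNReal.toReal_pos h0 (hnt t)), ENNReal.ofReal_toReal (hnt t)]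
  have hFp : ∀ t, ∫⁻ x, ‖F t x‖ₑ^p ∂ν = T.indicator (fun _ => 1) t *
      ((ENNReal.ofReal ((n t).toReal^(q-r)))^p * n t^r) := by
    intro t
    have := hvt t
    simp_rw [hFe, ENNReal.mul_rpow_of_nonneg _ _ hp0.le, hT01 _ p hp0, hS01 _ p hp0, ← ENNReal.rpow_mul, hpr]
    rw [lintegral_const_mul _ (by fun_prop), hSint, lintegral_mul_const _ (by fun_prop), mul_comm (lintegral _ _), ← hnr]
  have hJ1 : ∀ t, ∫⁻ x, ‖F t x‖ₑ * ‖v t x‖ₑ ∂ν = T.indicator (fun _ => 1) t *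
      ((ENNReal.ofReal ((n t).toReal^(q-r))) * n t^r) := by
    intro t
    have := hvt t
    have e : ∀ x, ‖F t x‖ₑ * ‖v t x‖ₑ = T.indicator (fun _ => 1) t * (S.indicator (fun _ => 1) x *
      (‖v t x‖ₑ^r * ENNReal.ofReal ((n t).toReal^(q-r)))) := by
      intro x
      rw [hFe]
      have : ‖v t x‖ₑ^r = ‖v t x‖ₑ^(r-1) * ‖v t x‖ₑ := by
        conv_rhs => rw [← ENNReal.rpow_one (‖v t x‖ₑ), ← ENNReal.rpow_mul, ← ENNReal.rpow_add_of_nonneg _ _ (by linarith) (by norm_num)]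
        congr 1; ring
      rw [this]; ring
    simp_rw [e]
    rw [lintegral_const_mul _ (by fun_prop), hSint, lintegral_mul_const _ (by fun_prop), mul_comm (lintegral _ _), ← hnr]
  have hJ2 : ∀ t, ∫⁻ x, ‖F t x‖ₑ * ‖v t x‖ₑ ∂ν = T.indicator (fun _ => 1) t * n t^q := by
    intro t
    rw [hJ1]
    congr 1
    rcases eq_or_ne (n t) 0 with h0 | h0
    · rw [h0, ENNReal.zero_rpow_of_pos (by linarith), ENNReal.zero_rpow_of_pos (by linarith), mul_zero]
    · rw [hnn t h0, ← ENNReal.rpow_add _ _ h0 (hnt t)]; congr 1; ring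
  have hFN : ∀ t, ∫⁻ x, ‖F t x‖ₑ^p ∂ν ≤ N t^p := by
    intro t
    rw [hFp]
    simp only [hN]
    rw [ENNReal.mul_rpow_of_nonneg _ _ hp0.le, hT01 _ p hp0]
    gcongr
    rcases eq_or_ne (n t) 0 with h0 | h0
    · rw [h0, ENNReal.zero_rpow_of_pos (by linarith : 0 < r), mul_zero]; exact zero_le
    · rw [hnn t h0, ← ENNReal.rpow_mul (n t) (q-r) p, ← ENNReal.rpow_mul (n t) (q-1) p, ← ENNReal.rpow_add _ _ h0 (hnt t)]
      apply le_of_eq; congr 1; linarith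
  have hbnd : ∀ y : ℝ, 0 ≤ y → ∫⁻ t, T.indicator (fun _ => 1) t * n t^y ≠ ⊤ := by
    intro y hy
    rw [hTint]
    have : ∫⁻ t in T, n t^y ≤ ∫⁻ t in T, (Mb^(1/r))^y := by
      apply lintegral_mono; intro t
      simp only [hn]
      gcongr
      exact hmb t
    refine (this.trans_lt ?_).ne
    rw [setLIntegral_const]
    have : (Mb^(1/r))^y ≠ ⊤ := ENNReal.rpow_ne_top_of_nonneg hy (ENNReal.rpow_ne_top_of_nonneg (by positivity) hMbt)
    finiteness
  have main := hD F N w hFm (mT.mul (hnm.pow_const _)) ?_ hFN (hbnd _ (by linarith)) ?_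
  · have e1 : ∫⁻ t, ∫⁻ x, ‖F t x‖ₑ * ‖inner ℂ w (Φ t x)‖ₑ ∂ν = ∫⁻ t, T.indicator (fun _ => 1) t * n t^q :=
      lintegral_congr hJ2
    have e2 : ∫⁻ t, N t^b = ∫⁻ t, T.indicator (fun _ => 1) t * n t^q := by
      apply lintegral_congr; intro t
      simp only [hN]
      rw [ENNReal.mul_rpow_of_nonneg _ _ hb0.le, hT01 _ b hb0, ← ENNReal.rpow_mul, hqb]
    rw [e1, e2, ← mul_assoc] at main
    have := absorb (by linarith) hb (hbnd q (by linarith)) main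
    rw [hTint] at this
    refine le_trans (le_of_eq ?_) this
    congr 1; ext t
    simp only [hn]
    rw [← ENNReal.rpow_mul]
    congr 1; ring
  · intro t
    simp only [hN]
    refine ENNReal.mul_ne_top ?_ (ENNReal.rpow_ne_top_of_nonneg (by linarith) (hnt t))
    by_cases ht : t ∈ T <;> simp [ht]
  · intro t x
    have e1 : F t x * v t x = ((c t x * ‖v t x‖^2 : ℝ) : ℂ) := by
      simp only [hF]
      rw [mul_assoc, ← Complex.normSq_eq_conj_mul_self, Complex.normSq_eq_norm_sq]
      push_cast; ring
    rw [show inner ℂ w (Φ t x) = v t x from rfl, e1, hFn]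
    congr 1; ring

lemma dual_full [SigmaFinite ν] {Φ : ℝ → X → H} {p b q r : ℝ} {C : ℝ≥0∞} (hD : DualBound ν Φ p b C)
    (hm : StronglyMeasurable (fun z : ℝ × X => Φ z.1 z.2)) {B : ℝ} (hB : ∀ t x, ‖Φ t x‖ ≤ B)
    (hq : 2 ≤ q) (hr : 2 ≤ r) (hb : 1/b + 1/q = 1) (hp : 1/p + 1/r = 1) (w : H) :
    ∫⁻ t, (∫⁻ x, ‖inner ℂ w (Φ t x)‖ₑ^r ∂ν)^(q/r) ≤ (‖w‖ₑ * C)^q := by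
  have hvm : Measurable (fun z : ℝ × X => inner ℂ w (Φ z.1 z.2)) :=
    (StronglyMeasurable.inner stronglyMeasurable_const hm).measurable
  have hqr : 0 < q/r := by positivity
  have mono : Monotone (spanningSets ν) := monotone_spanningSets ν
  have e1 : ∀ t, (∫⁻ x, ‖inner ℂ w (Φ t x)‖ₑ^r ∂ν)^(q/r) =
      ⨆ k, (∫⁻ x in spanningSets ν k, ‖inner ℂ w (Φ t x)‖ₑ^r ∂ν)^(q/r) := by
    intro t
    rw [← setLIntegral_univ, ← iUnion_spanningSets ν, setLIntegral_iUnion_of_directed _ mono.directed_le]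
    exact (ENNReal.orderIsoRpow (q/r) hqr).map_iSup _
  have step1 : ∀ R : ℕ, ∫⁻ t in Set.Icc (-(R:ℝ)) R, (∫⁻ x, ‖inner ℂ w (Φ t x)‖ₑ^r ∂ν)^(q/r) ≤ (‖w‖ₑ * C)^q := by
    intro R
    simp_rw [e1]
    rw [lintegral_iSup]
    · refine iSup_le fun k => ?_
      exact dual_step hD hm hB hq hr hb hp w measurableSet_Icc (measurableSet_spanningSets ν k)
        (by simp) (measure_spanningSets_lt_top ν k).ne
    · intro k
      exact (Measurable.lintegral_prod_right' (f := fun z : ℝ × X => ‖inner ℂ w (Φ z.1 z.2)‖ₑ^r) (by fun_prop)).pow_const _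
    · intro k l hkl t
      simp only
      gcongr
  have hU : (⋃ R : ℕ, Set.Icc (-(R:ℝ)) R) = Set.univ := by
    ext t
    simp only [Set.mem_iUnion, Set.mem_univ, iff_true]
    obtain ⟨R, hR⟩ := exists_nat_ge |t|
    exact ⟨R, abs_le.mp hR⟩
  rw [← setLIntegral_univ, ← hU, setLIntegral_iUnion_of_directed]
  · exact iSup_le step1
  · apply Monotone.directed_le
    intro k l hkl
    have : (k:ℝ) ≤ l := by exact_mod_cast hkl
    exact Set.Icc_subset_Icc (by linarith) this

/-- The fixed time bound. -/
lemma Disp.fixed_time [SigmaFinite ν] {σ : ℝ} {Φ : ℝ → X → H} (h : Disp ν σ Φ) (w : H) (t : ℝ) :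
    ∫⁻ x, ‖inner ℂ w (Φ t x)‖ₑ^2 ∂ν ≤ ‖w‖ₑ^2 := by
  have mono : Monotone (spanningSets ν) := monotone_spanningSets ν
  rw [← setLIntegral_univ, ← iUnion_spanningSets ν, setLIntegral_iUnion_of_directed _ mono.directed_le]
  refine iSup_le fun k => ?_
  set S := spanningSets ν k with hSdef
  have hS : MeasurableSet S := measurableSet_spanningSets ν k
  have hSf : ν S ≠ ⊤ := (measure_spanningSets_lt_top ν k).ne
  obtain ⟨B, hB⟩ := h.bdd
  have hΦ : StronglyMeasurable (Φ t) := h.meas.comp_measurable (by fun_prop : Measurable (fun x : X => (t, x)))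
  set v : X → ℂ := fun x => inner ℂ w (Φ t x) with hv
  have hvm : Measurable v := (StronglyMeasurable.inner stronglyMeasurable_const hΦ).measurable
  have hvB : ∀ x, ‖v x‖ ≤ ‖w‖ * B := fun x =>
    (norm_inner_le_norm _ _).trans (by gcongr; exact hB t x)
  set f : X → ℂ := S.indicator (fun x => (starRingEnd ℂ) (v x)) with hf
  have hcm : Measurable (fun x => (starRingEnd ℂ) (v x)) := Complex.continuous_conj.measurable.comp hvm
  have hfi : Integrable f ν := by
    rw [hf, integrable_indicator_iff hS]
    refine Measure.integrableOn_of_bounded (M := ‖w‖ * B) hSf hcm.aestronglyMeasurable ?_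
    filter_upwards with x
    rw [RCLike.norm_conj]; exact hvB x
  set J := ∫⁻ x in S, ‖v x‖ₑ^2 ∂ν with hJ
  have hJt : J ≠ ⊤ := by
    have : J ≤ ∫⁻ x in S, (ENNReal.ofReal (‖w‖ * B))^2 ∂ν := by
      apply lintegral_mono; intro x
      simp only
      gcongr
      rw [← ofReal_norm]
      exact ENNReal.ofReal_le_ofReal (hvB x)
    refine (this.trans_lt ?_).ne
    rw [setLIntegral_const]; finiteness
  have e1 : ∫⁻ x, ‖f x‖ₑ^2 ∂ν = J := by
    rw [hJ, ← lintegral_indicator hS]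
    congr 1; ext x
    by_cases hx : x ∈ S
    · simp [hf, hx, ← ofReal_norm]
    · simp [hf, hx]
  have e2 : inner ℂ w (∫ x, f x • Φ t x ∂ν) = ((∫ x in S, ‖v x‖^2 ∂ν : ℝ) : ℂ) := by
    rw [← integral_inner (h.smul_integrable t hfi), ← integral_indicator hS, ← integral_complex_ofReal]
    congr 1; ext x
    rw [inner_smul_right]
    by_cases hx : x ∈ S
    · simp only [hf, Set.indicator_of_mem hx]
      rw [show inner ℂ w (Φ t x) = v x from rfl, ← Complex.normSq_eq_conj_mul_self, Complex.normSq_eq_norm_sq]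
    · simp [hf, hx]
  have e3 : ‖inner ℂ w (∫ x, f x • Φ t x ∂ν)‖ₑ = J := by
    rw [e2, ← ofReal_norm, Complex.norm_real, Real.norm_of_nonneg (integral_nonneg fun x => by positivity),
      ofReal_integral_eq_lintegral_ofReal]
    · congr 1; ext x
      rw [ENNReal.ofReal_pow (norm_nonneg _), ofReal_norm]
    · refine Measure.integrableOn_of_bounded (M := (‖w‖ * B)^2) hSf (by fun_prop) ?_
      filter_upwards with x
      rw [Real.norm_of_nonneg (by positivity)]
      gcongr; exact hvB x
    · filter_upwards with x; positivity
  have e4 : J ≤ ‖w‖ₑ * J^(1/(2:ℝ)) := by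
    rw [← e3]
    refine (enorm_inner_le _ _).trans ?_
    gcongr
    rw [e3]
    have := h.l2 t f hfi
    rw [e1] at this
    have := sqrt_bound (C := 1) (by simpa using this : _ ≤ 1 * J)
    simpa using this
  have := absorb (q := 2) (by norm_num) (by norm_num) hJt e4
  exact_mod_cast this

end

set_option linter.unusedSectionVars false
section
variable {H : Type*} [NormedAddCommGroup H] [InnerProductSpace ℂ H]
  [CompleteSpace H]
variable {X : Type*} [MeasurableSpace X] {ν : Measure X} [SFinite ν]

lemma sup_step {Ψ : ℝ → H} (hm : StronglyMeasurable Ψ) {B : ℝ} (hB : ∀ t, ‖Ψ t‖ ≤ B)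
    {σ : ℝ} (h0 : 0 < σ) (h1 : σ < 1) {C : ℝ≥0∞}
    (hC : ∀ f : ℝ → ℝ≥0∞, Measurable f →
      ∫⁻ s, ∫⁻ t, ker σ s t * (f s * f t) ≤ C * (∫⁻ t, f t^(2/(2-σ)))^(2-σ))
    (hdisp : ∀ s t, ‖inner ℂ (Ψ s) (Ψ t)‖ₑ ≤ ker σ s t) (w : H) {T : Set ℝ} (hT : MeasurableSet T)
    (hTf : volume T ≠ ⊤) :
    ∫⁻ t in T, ‖inner ℂ w (Ψ t)‖ₑ^(2/σ) ≤ (‖w‖ₑ * C^(1/2:ℝ))^(2/σ) := by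
  set q := 2/σ with hq
  have hq2 : 2 < q := by rw [hq, lt_div_iff₀ h0]; linarith
  set f : ℝ → ℂ := fun t => inner ℂ w (Ψ t) with hf
  have hfm : Measurable f := (StronglyMeasurable.inner stronglyMeasurable_const hm).measurable
  have hfB : ∀ t, ‖f t‖ ≤ ‖w‖ * B := fun t => (norm_inner_le_norm _ _).trans (by gcongr; exact hB t)
  have hfBe : ∀ t, ‖f t‖ₑ ≤ ENNReal.ofReal (‖w‖ * B) := by
    intro t; rw [← ofReal_norm]; exact ENNReal.ofReal_le_ofReal (hfB t)
  set J := ∫⁻ t in T, ‖f t‖ₑ^q with hJ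
  have hJt : J ≠ ⊤ := by
    have : J ≤ ∫⁻ t in T, (ENNReal.ofReal (‖w‖ * B))^q := by
      apply lintegral_mono; intro t
      simp only
      gcongr
      exact hfBe t
    refine (this.trans_lt ?_).ne
    rw [setLIntegral_const]
    have : (ENNReal.ofReal (‖w‖ * B))^q ≠ ⊤ := ENNReal.rpow_ne_top_of_nonneg (by linarith) (by finiteness)
    finiteness
  set u : ℝ → ℂ := T.indicator (fun t => ((‖f t‖^(q-2) : ℝ) : ℂ) * (starRingEnd ℂ) (f t)) with hu
  have hum0 : Measurable (fun t => ((‖f t‖^(q-2) : ℝ) : ℂ) * (starRingEnd ℂ) (f t)) :=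
    (Complex.measurable_ofReal.comp (by fun_prop)).mul (Complex.continuous_conj.measurable.comp hfm)
  have hum : Measurable u := hum0.indicator hT
  set N : ℝ → ℝ≥0∞ := T.indicator (fun t => ‖f t‖ₑ^(q-1)) with hN
  have hNm : Measurable N := Measurable.indicator (by fun_prop) hT
  have hue : ∀ t, ‖u t‖ₑ = N t := by
    intro t
    by_cases ht : t ∈ T
    · simp only [hu, hN, Set.indicator_of_mem ht]
      rw [← ofReal_norm, norm_mul, RCLike.norm_conj, Complex.norm_real, Real.norm_of_nonneg (by positivity),
        ← ofReal_norm, ← enorm_rpow_of_real (norm_nonneg _) (by linarith)]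
      congr 1
      rcases eq_or_ne (f t) 0 with h0 | h0
      · rw [h0]; simp [Real.zero_rpow (show q - 1 ≠ 0 by linarith)]
      · rw [show q - 1 = (q-2) + 1 by ring, Real.rpow_add_one (by simpa using h0)]
    · simp [hu, hN, ht]
  set a : ℝ → H := fun t => u t • Ψ t with ha
  have hai : Integrable a := by
    refine ⟨(hum.stronglyMeasurable.smul hm).aestronglyMeasurable, ?_⟩
    rw [HasFiniteIntegral]
    have : ∀ t, ‖a t‖ₑ ≤ T.indicator (fun t => (ENNReal.ofReal (‖w‖ * B))^(q-1) * ENNReal.ofReal B) t := by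
      intro t
      simp only [ha]
      rw [enorm_smul, hue]
      by_cases ht : t ∈ T
      · simp only [hN, Set.indicator_of_mem ht]
        gcongr
        · linarith
        · exact hfBe t
        · rw [← ofReal_norm]; exact ENNReal.ofReal_le_ofReal (hB t)
      · simp [hN, ht]
    refine (lintegral_mono this).trans_lt ?_
    rw [lintegral_indicator hT, setLIntegral_const]
    have : (ENNReal.ofReal (‖w‖ * B))^(q-1) ≠ ⊤ := ENNReal.rpow_ne_top_of_nonneg (by linarith) (by finiteness)
    finiteness
  have hNb : ∫⁻ t, N t^(2/(2-σ)) = J := by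
    rw [hJ, ← lintegral_indicator hT]
    congr 1; ext t
    have h2 : 0 < 2/(2-σ) := div_pos (by norm_num) (by linarith)
    by_cases ht : t ∈ T
    · simp only [hN, Set.indicator_of_mem ht]
      rw [← ENNReal.rpow_mul]
      congr 1
      rw [hq]
      have : 2 - σ ≠ 0 := by linarith
      field_simp
    · simp [hN, ht, h2]
  have hA : ‖∫ t, a t‖ₑ^2 ≤ C * J^(2-σ) := by
    have e0 : ‖∫ t, a t‖ₑ^2 = ‖inner ℂ (∫ t, a t) (∫ t, a t)‖ₑ := by
      rw [inner_self_eq_norm_sq_to_K, enorm_pow]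
      congr 1
      simp [← ofReal_norm]
    rw [e0]
    refine (enorm_inner_int_int hai hai).trans ?_
    rw [← hNb]
    refine le_trans ?_ (hC N hNm)
    refine lintegral_mono fun s => lintegral_mono fun t => ?_
    simp only [ha]
    rw [inner_smul_left, inner_smul_right, enorm_mul, enorm_mul, hue, ← mul_assoc, mul_comm]
    gcongr
    · exact hdisp s t
    · rw [← hue s, ← ofReal_norm, RCLike.norm_conj, ofReal_norm]
  have hA2 := sqrt_bound hA
  rw [← ENNReal.rpow_mul] at hA2
  have e2 : inner ℂ w (∫ t, a t) = ((∫ t in T, ‖f t‖^q : ℝ) : ℂ) := by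
    rw [← integral_inner hai, ← integral_indicator hT, ← integral_complex_ofReal]
    congr 1; ext t
    simp only [ha]
    rw [inner_smul_right]
    by_cases ht : t ∈ T
    · simp only [hu, Set.indicator_of_mem ht]
      rw [show inner ℂ w (Ψ t) = f t from rfl, mul_assoc, ← Complex.normSq_eq_conj_mul_self, Complex.normSq_eq_norm_sq]
      rw [← Complex.ofReal_mul]
      congr 1
      rcases eq_or_ne (f t) 0 with h0 | h0
      · rw [h0]; simp [Real.zero_rpow (show q ≠ 0 by linarith)]
      · rw [← Real.rpow_natCast, ← Real.rpow_add (by simpa using h0)]; congr 1; push_cast; ring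
    · simp [hu, ht]
  have e3 : ‖inner ℂ w (∫ t, a t)‖ₑ = J := by
    rw [e2, ← ofReal_norm, Complex.norm_real, Real.norm_of_nonneg (integral_nonneg fun x => by positivity),
      ofReal_integral_eq_lintegral_ofReal]
    · rw [hJ]; congr 1; ext t
      rw [enorm_rpow_of_real (norm_nonneg _) (by linarith), ofReal_norm]
    · refine Measure.integrableOn_of_bounded (M := (‖w‖ * B)^q) hTf (hfm.norm.pow_const q).aestronglyMeasurable ?_
      filter_upwards with x
      rw [Real.norm_of_nonneg (by positivity)]
      gcongr; exact hfB x
    · filter_upwards with x; positivity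
  refine absorb (b := 2/(2-σ)) (by linarith) ?_ hJt ?_
  · rw [hq]
    have : 2 - σ ≠ 0 := by linarith
    field_simp; ring
  · calc J = ‖inner ℂ w (∫ t, a t)‖ₑ := e3.symm
      _ ≤ ‖w‖ₑ * ‖∫ t, a t‖ₑ := enorm_inner_le _ _
      _ ≤ ‖w‖ₑ * (C^(1/2:ℝ) * J^((2-σ)*(1/2))) := by gcongr
      _ = _ := by
        rw [mul_assoc]; congr 3
        field_simp

lemma Disp.sup {σ : ℝ} (h0 : 0 < σ) (h1 : σ < 1) :
    ∃ C : ℝ≥0∞, C ≠ ⊤ ∧ ∀ Φ : ℝ → X → H, Disp ν σ Φ → ∀ (w : H) (xs : ℕ → X),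
      ∫⁻ t, (⨆ i, ‖inner ℂ w (Φ t (xs i))‖ₑ)^(2/σ) ≤ (‖w‖ₑ * C)^(2/σ) := by
  obtain ⟨C, hC, -, hls⟩ := hls h0 h1
  refine ⟨C^(1/2:ℝ), by finiteness, ?_⟩
  intro Φ h w xs
  obtain ⟨B, hB⟩ := h.bdd
  have hvm : ∀ i, Measurable (fun t => ‖inner ℂ w (Φ t (xs i))‖ₑ) := by
    intro i
    have : StronglyMeasurable (fun t => Φ t (xs i)) :=
      h.meas.comp_measurable (by fun_prop : Measurable (fun t : ℝ => (t, xs i)))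
    exact (StronglyMeasurable.inner stronglyMeasurable_const this).measurable.enorm
  have hsm : ∀ K : ℕ, Measurable (fun t => (Finset.range K).sup (fun i => ‖inner ℂ w (Φ t (xs i))‖ₑ)) := by
    intro K
    induction K with
    | zero => simp
    | succ K ih =>
      simp_rw [Finset.range_add_one, Finset.sup_insert]
      exact (hvm K).sup ih
  have sel : ∀ K : ℕ, ∃ ι : ℝ → ℕ, Measurable ι ∧ ∀ t, ‖inner ℂ w (Φ t (xs (ι t)))‖ₑ =
      (Finset.range (K+1)).sup (fun i => ‖inner ℂ w (Φ t (xs i))‖ₑ) := by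
    intro K
    induction K with
    | zero => exact ⟨fun _ => 0, measurable_const, fun t => by simp⟩
    | succ K ih =>
      obtain ⟨ι, hι, he⟩ := ih
      classical
      have hms : MeasurableSet {t | (Finset.range (K+1)).sup (fun i => ‖inner ℂ w (Φ t (xs i))‖ₑ) ≤ ‖inner ℂ w (Φ t (xs (K+1)))‖ₑ} :=
        measurableSet_le (hsm (K+1)) (hvm _)
      refine ⟨fun t => if (Finset.range (K+1)).sup (fun i => ‖inner ℂ w (Φ t (xs i))‖ₑ) ≤ ‖inner ℂ w (Φ t (xs (K+1)))‖ₑ then K+1 else ι t,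
        Measurable.ite hms measurable_const hι, fun t => ?_⟩
      simp only
      rw [Finset.range_add_one (n := K+1), Finset.sup_insert]
      by_cases hle : (Finset.range (K+1)).sup (fun i => ‖inner ℂ w (Φ t (xs i))‖ₑ) ≤ ‖inner ℂ w (Φ t (xs (K+1)))‖ₑ
      · rw [if_pos hle, sup_of_le_left hle]
      · rw [if_neg hle, sup_of_le_right (not_le.mp hle).le, he]
  have stepK : ∀ (K R : ℕ), ∫⁻ t in Set.Icc (-(R:ℝ)) R, ((Finset.range (K+1)).sup (fun i => ‖inner ℂ w (Φ t (xs i))‖ₑ))^(2/σ) ≤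
      (‖w‖ₑ * C^(1/2:ℝ))^(2/σ) := by
    intro K R
    obtain ⟨ι, hι, he⟩ := sel K
    simp_rw [← he]
    refine sup_step (Ψ := fun t => Φ t (xs (ι t))) (h.meas.comp_measurable (measurable_id.prodMk ((measurable_from_nat (f := xs)).comp hι)))
      (fun t => hB t _) h0 h1 hls (fun s t => h.disp s t _ _) w measurableSet_Icc (by simp)
  have hσ : 0 < 2/σ := by positivity
  have e1 : ∀ t, (⨆ i, ‖inner ℂ w (Φ t (xs i))‖ₑ)^(2/σ) =
      ⨆ K : ℕ, ((Finset.range (K+1)).sup (fun i => ‖inner ℂ w (Φ t (xs i))‖ₑ))^(2/σ) := by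
    intro t
    have : (⨆ i, ‖inner ℂ w (Φ t (xs i))‖ₑ) = ⨆ K : ℕ, (Finset.range (K+1)).sup (fun i => ‖inner ℂ w (Φ t (xs i))‖ₑ) := by
      apply le_antisymm
      · refine iSup_le fun i => le_iSup_of_le i ?_
        exact Finset.le_sup (f := fun i => ‖inner ℂ w (Φ t (xs i))‖ₑ) (Finset.mem_range.mpr (Nat.lt_succ_self i))
      · refine iSup_le fun K => Finset.sup_le fun i _ => le_iSup (fun i => ‖inner ℂ w (Φ t (xs i))‖ₑ) i
    rw [this]
    exact (ENNReal.orderIsoRpow (2/σ) hσ).map_iSup _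
  have hU : (⋃ R : ℕ, Set.Icc (-(R:ℝ)) R) = Set.univ := by
    ext t
    simp only [Set.mem_iUnion, Set.mem_univ, iff_true]
    obtain ⟨R, hR⟩ := exists_nat_ge |t|
    exact ⟨R, abs_le.mp hR⟩
  simp_rw [e1]
  rw [lintegral_iSup]
  · refine iSup_le fun K => ?_
    rw [← setLIntegral_univ, ← hU, setLIntegral_iUnion_of_directed]
    · exact iSup_le (stepK K)
    · apply Monotone.directed_le
      intro k l hkl
      have : (k:ℝ) ≤ l := by exact_mod_cast hkl
      exact Set.Icc_subset_Icc (by linarith) this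
  · intro K
    refine Measurable.pow_const ?_ _
    exact hsm (K+1)
  · intro k l hkl t
    simp only
    gcongr

end

/-- The (regularised) Schrödinger kernel. -/
def gk (d : ℕ) (b : ℂ) (z : EuclideanSpace ℝ (Fin d)) : ℂ :=
  ((((2 * Real.pi)^d)⁻¹ : ℝ) : ℂ) * ((Real.pi : ℂ) / b)^((d : ℂ)/2) * cexp (-((‖z‖ : ℂ)^2) / (4 * b))

/-- The Fourier side Gaussian. -/
def phf (d : ℕ) (ε t : ℝ) (x ξ : EuclideanSpace ℝ (Fin d)) : ℂ :=
  (((Real.sqrt ((2 * Real.pi)^d))⁻¹ : ℝ) : ℂ) *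
    cexp (-((ε/2 : ℝ) - t * I : ℂ) * (‖ξ‖ : ℂ)^2 + (-I) * (inner ℝ x ξ : ℝ))

lemma phf_mul (d : ℕ) (ε t s : ℝ) (x y ξ : EuclideanSpace ℝ (Fin d)) :
    inner ℂ (phf d ε t x ξ) (phf d ε s y ξ) = ((((2 * Real.pi)^d)⁻¹ : ℝ) : ℂ) *
      cexp (-((ε : ℂ) + (t - s : ℝ) * I) * (‖ξ‖ : ℂ)^2 + I * (inner ℝ (x - y) ξ : ℝ)) := by
  have h2 : (((Real.sqrt ((2 * Real.pi)^d))⁻¹ : ℝ) : ℂ) * (((Real.sqrt ((2 * Real.pi)^d))⁻¹ : ℝ) : ℂ)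
      = ((((2 * Real.pi)^d)⁻¹ : ℝ) : ℂ) := by
    rw [← ofReal_mul, ← mul_inv, Real.mul_self_sqrt (by positivity)]
  rw [RCLike.inner_apply, phf, phf, map_mul, conj_ofReal, ← Complex.exp_conj, ← h2, inner_sub_left]
  rw [show ∀ a b c e : ℂ, a * b * (c * e) = (a * c) * (e * b) by intros; ring, ← Complex.exp_add]
  congr 2
  simp only [map_add, map_mul, map_neg, map_sub, conj_ofReal, conj_I, map_pow]
  push_cast
  ring

lemma phf_memLp (d : ℕ) {ε : ℝ} (hε : 0 < ε) (t : ℝ) (x : EuclideanSpace ℝ (Fin d)) :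
    MemLp (phf d ε t x) 2 volume := by
  have hc : Continuous (phf d ε t x) := by unfold phf; fun_prop
  rw [memLp_two_iff_integrable_sq_norm hc.aestronglyMeasurable]
  have hb : 0 < ((ε : ℂ) + ((t - t : ℝ) : ℂ) * I).re := by simpa using hε
  have h := ((GaussianFourier.integrable_cexp_neg_mul_sq_norm_add_of_euclideanSpace (ι := Fin d) hb I (x - x)).const_mul
    ((((2 * Real.pi)^d)⁻¹ : ℝ) : ℂ)).norm
  refine h.congr ?_
  filter_upwards with ξ
  rw [← phf_mul]
  simp only [inner_self_eq_norm_sq_to_K]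
  simp

/-- The vectors. -/
def PH (d : ℕ) {ε : ℝ} (hε : 0 < ε) (t : ℝ) (x : EuclideanSpace ℝ (Fin d)) :
    Lp ℂ 2 (volume : Measure (EuclideanSpace ℝ (Fin d))) := (phf_memLp d hε t x).toLp _

lemma PH_inner (d : ℕ) {ε : ℝ} (hε : 0 < ε) (t s : ℝ) (x y : EuclideanSpace ℝ (Fin d)) :
    inner ℂ (PH d hε t x) (PH d hε s y) = gk d ((ε : ℂ) + (t - s : ℝ) * I) (x - y) := by
  have hb : 0 < ((ε : ℂ) + ((t - s : ℝ) : ℂ) * I).re := by simpa using hε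
  rw [MeasureTheory.L2.inner_def]
  rw [integral_congr_ae (g := fun ξ => ((((2 * Real.pi)^d)⁻¹ : ℝ) : ℂ) *
      cexp (-((ε : ℂ) + (t - s : ℝ) * I) * (‖ξ‖ : ℂ)^2 + I * (inner ℝ (x - y) ξ : ℝ)))]
  · rw [integral_const_mul, GaussianFourier.integral_cexp_neg_mul_sq_norm_add_of_euclideanSpace hb]
    simp only [gk, Fintype.card_fin, I_sq]
    rw [mul_assoc]
    congr 4
    ring
  · filter_upwards [(phf_memLp d hε t x).coeFn_toLp, (phf_memLp d hε s y).coeFn_toLp] with ξ h1 h2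
    rw [← phf_mul, ← h1, ← h2]
    rfl

lemma gk_cont (d : ℕ) {Y : Type*} [TopologicalSpace Y] {b : Y → ℂ} {z : Y → EuclideanSpace ℝ (Fin d)}
    (hb : Continuous b) (hz : Continuous z) (h : ∀ y, 0 ≤ (b y).re) (h0 : ∀ y, b y ≠ 0) :
    Continuous (fun y => gk d (b y) (z y)) := by
  unfold gk
  have hs : ∀ y, (Real.pi : ℂ) / b y ∈ slitPlane := by
    intro y
    rw [div_eq_mul_inv, mem_slitPlane_iff]
    have hn : 0 < normSq (b y) := normSq_pos.2 (h0 y)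
    simp only [re_ofReal_mul, im_ofReal_mul, inv_re, inv_im]
    rcases (h y).lt_or_eq with h1 | h1
    · left; positivity
    · right
      have : (b y).im ≠ 0 := by
        intro h2; exact h0 y (Complex.ext h1.symm h2)
      have hp := Real.pi_pos.ne'
      simp [hp, this, hn.ne']
  refine (continuous_const.mul ?_).mul ?_
  · refine Continuous.cpow (continuous_const.div hb h0) continuous_const hs
  · refine continuous_exp.comp ?_
    exact Continuous.div (by fun_prop) (by fun_prop) (fun y => by simpa using h0 y)

lemma gk_norm_le (d : ℕ) {b : ℂ} (hb : 0 ≤ b.re) (h0 : b ≠ 0) (z : EuclideanSpace ℝ (Fin d)) :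
    ‖gk d b z‖ ≤ ‖b‖^(-((d : ℝ)/2)) := by
  have hbp : 0 < ‖b‖ := norm_pos_iff.2 h0
  have h1 : ‖((Real.pi : ℂ) / b)^((d : ℂ)/2)‖ = (Real.pi)^((d:ℝ)/2) * ‖b‖^(-((d : ℝ)/2)) := by
    have := Complex.norm_cpow_real ((Real.pi : ℂ) / b) ((d : ℝ)/2)
    push_cast at this
    rw [this, norm_div, norm_real, Real.norm_of_nonneg Real.pi_pos.le,
      Real.div_rpow Real.pi_pos.le (norm_nonneg _), Real.rpow_neg (norm_nonneg _), div_eq_mul_inv]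
  have h2 : ‖cexp (-((‖z‖ : ℂ)^2) / (4 * b))‖ ≤ 1 := by
    rw [norm_exp, Real.exp_le_one_iff]
    have : -((‖z‖ : ℂ)^2) / (4 * b) = ((-(‖z‖^2)/4 : ℝ) : ℂ) * b⁻¹ := by
      push_cast; field_simp
    rw [this, re_ofReal_mul, inv_re]
    have : 0 ≤ ‖z‖^2/4 * (b.re / normSq b) := by
      have := normSq_nonneg b; positivity
    linarith
  rw [gk, norm_mul, norm_mul, h1, norm_real, Real.norm_of_nonneg (by positivity)]
  have h3 : ((2 * Real.pi)^d)⁻¹ * (Real.pi)^((d:ℝ)/2) ≤ 1 := by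
    rw [inv_mul_le_iff₀ (by positivity), mul_one, ← Real.rpow_natCast]
    have hp : 1 ≤ Real.pi := by linarith [Real.pi_gt_three]
    calc (Real.pi)^((d:ℝ)/2) ≤ Real.pi^(d:ℝ) := Real.rpow_le_rpow_of_exponent_le hp (by
            have : (0:ℝ) ≤ d := by positivity
            linarith)
      _ ≤ _ := Real.rpow_le_rpow (by positivity) (by linarith) (by positivity)
  have h4 : 0 ≤ ‖b‖^(-((d : ℝ)/2)) := by positivity
  calc _ ≤ ((2 * Real.pi)^d)⁻¹ * ((Real.pi)^((d:ℝ)/2) * ‖b‖^(-((d : ℝ)/2))) * 1 := by gcongr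
    _ = (((2 * Real.pi)^d)⁻¹ * (Real.pi)^((d:ℝ)/2)) * ‖b‖^(-((d : ℝ)/2)) := by ring
    _ ≤ 1 * ‖b‖^(-((d : ℝ)/2)) := by gcongr
    _ = _ := one_mul _

lemma gk_lintegral (d : ℕ) {ε : ℝ} (hε : 0 < ε) :
    ∫⁻ z : EuclideanSpace ℝ (Fin d), ‖gk d (ε : ℂ) z‖ₑ = 1 := by
  have hb : 0 < 1/(4*ε) := by positivity
  have e : ∀ z : EuclideanSpace ℝ (Fin d), ‖gk d (ε : ℂ) z‖ₑ =
      ENNReal.ofReal ((((2 * Real.pi)^d)⁻¹ * (Real.pi/ε)^((d:ℝ)/2)) * Real.exp (-(1/(4*ε)) * ‖z‖^2)) := by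
    intro z
    have h1 : ‖((Real.pi : ℂ) / ε)^((d : ℂ)/2)‖ = (Real.pi/ε)^((d:ℝ)/2) := by
      have := Complex.norm_cpow_real ((Real.pi : ℂ) / ε) ((d : ℝ)/2)
      push_cast at this
      rw [this, norm_div, norm_real, norm_real, Real.norm_of_nonneg Real.pi_pos.le, Real.norm_of_nonneg hε.le]
    rw [← ofReal_norm, gk, norm_mul, norm_mul, h1, norm_real, Real.norm_of_nonneg (by positivity), norm_exp]
    congr 3
    have : -((‖z‖ : ℂ)^2) / (4 * ε) = ((-(1/(4*ε)) * ‖z‖^2 : ℝ) : ℂ) := by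
      push_cast; field_simp
    rw [this, ofReal_re]
  simp_rw [e]
  have hi : Integrable (fun z : EuclideanSpace ℝ (Fin d) => Real.exp (-(1/(4*ε)) * ‖z‖^2)) := by
    have hb' : 0 < (((1/(4*ε) : ℝ) : ℂ)).re := by simpa using hε
    have := (GaussianFourier.integrable_cexp_neg_mul_sq_norm_add_of_euclideanSpace (ι := Fin d) hb' 0 0).norm
    refine this.congr ?_
    filter_upwards with z
    rw [norm_exp, zero_mul, add_zero]
    have : -((1/(4*ε) : ℝ) : ℂ) * (‖z‖ : ℂ)^2 = ((-(1/(4*ε)) * ‖z‖^2 : ℝ) : ℂ) := by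
      push_cast; ring
    rw [this, ofReal_re]
  rw [← ofReal_integral_eq_lintegral_ofReal (hi.const_mul _) (by filter_upwards with z; positivity),
    integral_const_mul, GaussianFourier.integral_rexp_neg_mul_sq_norm hb, finrank_euclideanSpace_fin,
    mul_assoc, ← Real.mul_rpow (by positivity) (by positivity)]
  have : Real.pi / ε * (Real.pi / (1/(4*ε))) = (2*Real.pi)^(2:ℝ) := by
    norm_num
    field_simp
    ring
  rw [this, ← Real.rpow_mul (by positivity), show (2:ℝ)*((d:ℝ)/2) = d by ring, Real.rpow_natCast,
    inv_mul_cancel₀ (by positivity)]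
  simp

lemma PH_cont (d : ℕ) {ε : ℝ} (hε : 0 < ε) :
    Continuous (fun z : ℝ × EuclideanSpace ℝ (Fin d) => PH d hε z.1 z.2) := by
  rw [continuous_iff_continuousAt]
  intro z0
  rw [ContinuousAt, tendsto_iff_norm_sub_tendsto_zero]
  have key : ∀ z : ℝ × EuclideanSpace ℝ (Fin d), ‖PH d hε z.1 z.2 - PH d hε z0.1 z0.2‖ =
      Real.sqrt ((gk d ((ε : ℂ) + (z.1 - z.1 : ℝ) * I) (z.2 - z.2)).re
        - 2 * (gk d ((ε : ℂ) + (z.1 - z0.1 : ℝ) * I) (z.2 - z0.2)).re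
        + (gk d ((ε : ℂ) + (z0.1 - z0.1 : ℝ) * I) (z0.2 - z0.2)).re) := by
    intro z
    rw [← Real.sqrt_sq (norm_nonneg (PH d hε z.1 z.2 - _)), norm_sub_sq (𝕜 := ℂ)]
    congr 1
    rw [norm_sq_eq_re_inner (𝕜 := ℂ) (PH d hε z.1 z.2), norm_sq_eq_re_inner (𝕜 := ℂ) (PH d hε z0.1 z0.2),
      PH_inner, PH_inner, PH_inner]
    rfl
  have hgc : ∀ (u : ℝ × EuclideanSpace ℝ (Fin d) → ℝ) (v : ℝ × EuclideanSpace ℝ (Fin d) → EuclideanSpace ℝ (Fin d)),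
      Continuous u → Continuous v → Continuous (fun z => (gk d ((ε : ℂ) + (u z : ℝ) * I) (v z)).re) := by
    intro u v hu hv
    refine continuous_re.comp (gk_cont d (by fun_prop) hv ?_ ?_)
    · intro y; simpa using hε.le
    · intro y h
      have := congrArg Complex.re h
      simp at this
      exact hε.ne' this
  have hc : Continuous (fun z : ℝ × EuclideanSpace ℝ (Fin d) => ‖PH d hε z.1 z.2 - PH d hε z0.1 z0.2‖) := by
    simp_rw [key]
    refine Real.continuous_sqrt.comp (((hgc _ _ ?_ ?_).sub (continuous_const.mul (hgc _ _ ?_ ?_))).add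
      (hgc _ _ ?_ ?_))
    all_goals fun_prop
  have := hc.tendsto z0
  simpa using this

lemma two_mul_le_ennreal (a b : ℝ≥0∞) : 2 * (a * b) ≤ a^2 + b^2 := by
  by_cases ha : a = ⊤
  · simp [ha]
  by_cases hb : b = ⊤
  · simp [hb]
  lift a to ℝ≥0 using ha
  lift b to ℝ≥0 using hb
  norm_cast
  rw [← NNReal.coe_le_coe]
  push_cast
  nlinarith [sq_nonneg ((a:ℝ) - b)]

lemma PH_l2 (d : ℕ) {ε : ℝ} (hε : 0 < ε) (t : ℝ) (f : EuclideanSpace ℝ (Fin d) → ℂ)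
    (hf : Integrable f) (hi : Integrable (fun x => f x • PH d hε t x)) :
    ‖∫ x, f x • PH d hε t x‖ₑ^2 ≤ ∫⁻ x, ‖f x‖ₑ^2 := by
  set V := ∫ x, f x • PH d hε t x with hV
  have h1 : ‖V‖ₑ^2 = ‖inner ℂ V V‖ₑ := by
    rw [inner_self_eq_norm_sq_to_K, enorm_pow]
    congr 1
    simp [← ofReal_norm]
  have hgm : Measurable (fun z : EuclideanSpace ℝ (Fin d) => ‖gk d (ε : ℂ) z‖ₑ) := by
    refine (Continuous.enorm ?_).measurable
    exact gk_cont d continuous_const continuous_id (by intro _; simpa using hε.le)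
      (by intro _; exact_mod_cast hε.ne')
  have h2 : ∀ y, ‖inner ℂ V (f y • PH d hε t y)‖ₑ ≤ ∫⁻ x, ‖f y‖ₑ * (‖f x‖ₑ * ‖gk d (ε : ℂ) (y - x)‖ₑ) := by
    intro y
    rw [inner_smul_right, enorm_mul, lintegral_const_mul' _ _ (by finiteness)]
    gcongr
    rw [enorm_inner_symm]
    refine (enorm_inner_integral_le _ hi).trans (lintegral_mono fun x => ?_)
    simp only [inner_smul_right, enorm_mul, PH_inner]
    simp
  have hfm : AEMeasurable (fun x => ‖f x‖ₑ) := hf.1.enorm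
  have hfin : ∀ A : ℝ≥0∞, 2 * A ≤ 2 * (∫⁻ x, ‖f x‖ₑ^2) → A ≤ ∫⁻ x, ‖f x‖ₑ^2 := by
    intro A hA
    exact (ENNReal.mul_le_mul_iff_right (by norm_num) (by norm_num)).1 hA
  apply hfin
  rw [h1]
  have hm1 : AEMeasurable (fun p : EuclideanSpace ℝ (Fin d) × EuclideanSpace ℝ (Fin d) =>
      ‖f p.1‖ₑ^2 * ‖gk d (ε : ℂ) (p.1 - p.2)‖ₑ) (volume.prod volume) := by
    refine AEMeasurable.fun_mul ?_ ?_
    · exact (hfm.comp_quasiMeasurePreserving Measure.quasiMeasurePreserving_fst).pow_const 2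
    · exact (hgm.comp (by fun_prop)).aemeasurable
  have hm2 : AEMeasurable (fun p : EuclideanSpace ℝ (Fin d) × EuclideanSpace ℝ (Fin d) =>
      ‖f p.2‖ₑ^2 * ‖gk d (ε : ℂ) (p.1 - p.2)‖ₑ) (volume.prod volume) := by
    refine AEMeasurable.fun_mul ?_ ?_
    · exact (hfm.comp_quasiMeasurePreserving Measure.quasiMeasurePreserving_snd).pow_const 2
    · exact (hgm.comp (by fun_prop)).aemeasurable
  have i1 : ∫⁻ y, ∫⁻ x, ‖f y‖ₑ^2 * ‖gk d (ε : ℂ) (y - x)‖ₑ = ∫⁻ x, ‖f x‖ₑ^2 := by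
    refine lintegral_congr fun y => ?_
    rw [lintegral_const_mul' _ _ (by finiteness), lintegral_sub_left_eq_self (fun z => ‖gk d (ε : ℂ) z‖ₑ) y,
      gk_lintegral d hε, mul_one]
  have i2 : ∫⁻ y, ∫⁻ x, ‖f x‖ₑ^2 * ‖gk d (ε : ℂ) (y - x)‖ₑ = ∫⁻ x, ‖f x‖ₑ^2 := by
    rw [lintegral_lintegral_swap hm2]
    refine lintegral_congr fun y => ?_
    rw [lintegral_const_mul' _ _ (by finiteness), lintegral_sub_right_eq_self (fun z => ‖gk d (ε : ℂ) z‖ₑ) y,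
      gk_lintegral d hε, mul_one]
  calc 2 * ‖inner ℂ V V‖ₑ ≤ 2 * ∫⁻ y, ∫⁻ x, ‖f y‖ₑ * (‖f x‖ₑ * ‖gk d (ε : ℂ) (y - x)‖ₑ) := by
        gcongr
        exact (enorm_inner_integral_le V hi).trans (lintegral_mono h2)
    _ = ∫⁻ y, ∫⁻ x, 2 * (‖f y‖ₑ * (‖f x‖ₑ * ‖gk d (ε : ℂ) (y - x)‖ₑ)) := by
        rw [← lintegral_const_mul' _ _ (by norm_num)]
        refine lintegral_congr fun y => ?_
        rw [← lintegral_const_mul' _ _ (by norm_num)]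
    _ ≤ ∫⁻ y, ∫⁻ x, (‖f y‖ₑ^2 * ‖gk d (ε : ℂ) (y - x)‖ₑ + ‖f x‖ₑ^2 * ‖gk d (ε : ℂ) (y - x)‖ₑ) := by
        refine lintegral_mono fun y => lintegral_mono fun x => ?_
        simp only
        rw [← add_mul, ← mul_assoc, ← mul_assoc, mul_assoc 2]
        gcongr
        exact two_mul_le_ennreal _ _
    _ = ∫⁻ y, (∫⁻ x, ‖f y‖ₑ^2 * ‖gk d (ε : ℂ) (y - x)‖ₑ) + ∫⁻ x, ‖f x‖ₑ^2 * ‖gk d (ε : ℂ) (y - x)‖ₑ := by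
        refine lintegral_congr fun y => ?_
        rw [lintegral_add_left]
        exact (hgm.comp (by fun_prop)).const_mul _
    _ = 2 * ∫⁻ x, ‖f x‖ₑ^2 := by
        rw [lintegral_add_left' hm1.lintegral_prod_right', i1, i2, two_mul]

lemma PH_bdd (d : ℕ) {ε : ℝ} (hε : 0 < ε) (t : ℝ) (x : EuclideanSpace ℝ (Fin d)) :
    ‖PH d hε t x‖ ≤ Real.sqrt (gk d (ε : ℂ) 0).re := by
  apply Real.le_sqrt_of_sq_le
  rw [norm_sq_eq_re_inner (𝕜 := ℂ), PH_inner]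
  simp

lemma PH_disp (d : ℕ) (hd : 1 ≤ d) {ε : ℝ} (hε : 0 < ε) :
    Disp (volume : Measure (EuclideanSpace ℝ (Fin d))) ((d:ℝ)/2) (PH d hε) := by
  have hd0 : (0:ℝ) < d := by exact_mod_cast hd
  refine ⟨(PH_cont d hε).stronglyMeasurable, ⟨_, PH_bdd d hε⟩, ?_, ?_⟩
  · intro t f hf
    refine PH_l2 d hε t f hf ?_
    refine Integrable.mono' (hf.norm.mul_const (Real.sqrt (gk d (ε : ℂ) 0).re)) (hf.1.smul ?_) ?_
    · exact ((PH_cont d hε).comp (by fun_prop : Continuous (fun x => (t, x)))).aestronglyMeasurable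
    · filter_upwards with x
      rw [norm_smul]
      gcongr
      exact PH_bdd d hε t x
  · intro t s x y
    rw [PH_inner, ker]
    by_cases hts : s = t
    · rw [hts]
      simp [ENNReal.zero_rpow_of_neg (show -((d:ℝ)/2) < 0 by linarith)]
    have hp : 0 < |s - t| := abs_pos.2 (sub_ne_zero.2 hts)
    have hle : |s - t| ≤ ‖(ε : ℂ) + (t - s : ℝ) * I‖ := by
      have := Complex.abs_im_le_norm ((ε : ℂ) + (t - s : ℝ) * I)
      rw [abs_sub_comm]
      simpa using this
    have h0 : (ε : ℂ) + (t - s : ℝ) * I ≠ 0 := norm_pos_iff.1 (hp.trans_le hle)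
    rw [← ofReal_norm, ENNReal.ofReal_rpow_of_pos hp]
    refine ENNReal.ofReal_le_ofReal ((gk_norm_le d (by simpa using hε.le) h0 _).trans ?_)
    exact Real.rpow_le_rpow_of_nonpos hp hle (by linarith)

lemma gk_I (d : ℕ) {t : ℝ} (ht : t ≠ 0) (z : EuclideanSpace ℝ (Fin d)) :
    gk d ((t : ℂ) * I) z = (((4 * Real.pi * t : ℝ) : ℂ) * I) ^ (-(d : ℂ) / 2) *
      cexp (I * ((‖z‖ : ℝ) : ℂ) ^ 2 / ((4 * t : ℝ) : ℂ)) := by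
  have htc : (t : ℂ) ≠ 0 := by exact_mod_cast ht
  have hpc : (Real.pi : ℂ) ≠ 0 := by exact_mod_cast Real.pi_ne_zero
  have hA0 : ((4 * Real.pi * t : ℝ) : ℂ) * I ≠ 0 := by
    push_cast
    simp [htc, hpc]
  have harg : (((4 * Real.pi * t : ℝ) : ℂ) * I).arg ≠ Real.pi := by
    intro h
    rw [arg_eq_pi_iff] at h
    have := h.2
    simp [ht, Real.pi_ne_zero] at this
  have e1 : (Real.pi : ℂ) / ((t : ℂ) * I) = ((4 * Real.pi^2 : ℝ) : ℂ) * (((4 * Real.pi * t : ℝ) : ℂ) * I)⁻¹ := by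
    push_cast
    field_simp
  have hp : (0:ℝ) < 4 * Real.pi^2 := by positivity
  have e2 : ((Real.pi : ℂ) / ((t : ℂ) * I))^((d : ℂ)/2) =
      (((2 * Real.pi)^d : ℝ) : ℂ) * (((4 * Real.pi * t : ℝ) : ℂ) * I) ^ (-(d : ℂ) / 2) := by
    rw [e1, neg_div, cpow_neg, ← inv_cpow _ _ harg, cpow_def_of_ne_zero (by
      refine mul_ne_zero ?_ (inv_ne_zero hA0)
      exact_mod_cast hp.ne'), log_ofReal_mul hp (inv_ne_zero hA0), add_mul, Complex.exp_add,
      cpow_def_of_ne_zero (inv_ne_zero hA0)]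
    congr 1
    have : ((Real.log (4 * Real.pi^2) : ℝ) : ℂ) * ((d:ℂ)/2) = ((d : ℝ) * Real.log (2 * Real.pi) : ℝ) := by
      rw [show 4 * Real.pi^2 = (2 * Real.pi)^2 by ring, Real.log_pow]
      push_cast; ring
    rw [this, ← ofReal_exp, ← Real.log_pow, Real.exp_log (by positivity)]
  have hc : ((((2 * Real.pi)^d)⁻¹ : ℝ) : ℂ) * (((2 * Real.pi)^d : ℝ) : ℂ) = 1 := by
    rw [← ofReal_mul, inv_mul_cancel₀ (by positivity), ofReal_one]
  rw [gk, e2, ← mul_assoc, hc, one_mul]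
  congr 2
  push_cast
  field_simp
  rw [I_sq]
  ring

/-- Regularised initial datum. -/
def WD (d : ℕ) {ε : ℝ} (hε : 0 < ε) (φ : EuclideanSpace ℝ (Fin d) → ℂ) :
    Lp ℂ 2 (volume : Measure (EuclideanSpace ℝ (Fin d))) := ∫ y, φ y • PH d hε 0 y

lemma WD_norm (d : ℕ) (hd : 1 ≤ d) {ε : ℝ} (hε : 0 < ε) {φ : EuclideanSpace ℝ (Fin d) → ℂ}
    (hφ : Integrable φ) : ‖WD d hε φ‖ₑ ≤ eLpNorm φ 2 volume := by
  have h := (PH_disp d hd hε).l2 0 φ hφ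
  have e : eLpNorm φ 2 volume = (∫⁻ x, ‖φ x‖ₑ^2)^(1/2:ℝ) := by
    rw [eLpNorm_eq_lintegral_rpow_enorm_toReal (by norm_num) (by norm_num)]
    simp
  rw [e]
  calc ‖WD d hε φ‖ₑ = (‖WD d hε φ‖ₑ^2)^(1/2:ℝ) := by
        rw [← ENNReal.rpow_natCast, ← ENNReal.rpow_mul]; norm_num
    _ ≤ _ := by
        gcongr
        exact h

lemma WD_inner (d : ℕ) (hd : 1 ≤ d) {ε : ℝ} (hε : 0 < ε) {φ : EuclideanSpace ℝ (Fin d) → ℂ}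
    (hφ : Integrable φ) (t : ℝ) (x : EuclideanSpace ℝ (Fin d)) :
    inner ℂ (PH d hε t x) (WD d hε φ) = ∫ y, φ y * gk d ((ε : ℂ) + t * I) (x - y) := by
  rw [WD, ← integral_inner ((PH_disp d hd hε).smul_integrable 0 hφ)]
  simp only [inner_smul_right, PH_inner, sub_zero]

lemma WD_tendsto (d : ℕ) (hd : 1 ≤ d) {e : ℕ → ℝ} (he : ∀ n, 0 < e n)
    (hl : Filter.Tendsto e Filter.atTop (nhds 0)) {φ : EuclideanSpace ℝ (Fin d) → ℂ}
    (hφ : Integrable φ) {t : ℝ} (ht : t ≠ 0) (x : EuclideanSpace ℝ (Fin d)) :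
    Filter.Tendsto (fun n => inner ℂ (PH d (he n) t x) (WD d (he n) φ)) Filter.atTop
      (nhds (schrod d t φ x)) := by
  simp_rw [fun n => WD_inner d hd (he n) hφ t x]
  have hs : schrod d t φ x = ∫ y, φ y * gk d ((t : ℂ) * I) (x - y) := by
    rw [schrod, ← integral_const_mul]
    congr 1
    ext y
    rw [gk_I d ht]
    ring
  have hn : ∀ s : ℝ, |t| ≤ ‖(s : ℂ) + (t : ℂ) * I‖ := by
    intro s
    have := Complex.abs_im_le_norm ((s : ℂ) + (t : ℝ) * I)
    simpa using this
  have hp : 0 < |t| := abs_pos.2 ht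
  have hne : ∀ s : ℝ, (s : ℂ) + (t : ℂ) * I ≠ 0 := fun s => norm_pos_iff.1 (hp.trans_le (hn s))
  rw [hs]
  refine tendsto_integral_of_dominated_convergence (fun y => ‖φ y‖ * |t|^(-((d:ℝ)/2))) ?_ (hφ.norm.mul_const _) ?_ ?_
  · intro n
    refine hφ.1.mul (Continuous.aestronglyMeasurable ?_)
    exact gk_cont d continuous_const (by fun_prop) (by intro _; simpa using (he n).le) (fun _ => hne _)
  · intro n
    filter_upwards with y
    rw [norm_mul]
    gcongr
    refine (gk_norm_le d (by simpa using (he n).le) (hne _) _).trans ?_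
    exact Real.rpow_le_rpow_of_nonpos hp (hn _) (by have : (0:ℝ) ≤ d := by positivity
                                                    linarith)
  · filter_upwards with y
    refine tendsto_const_nhds.mul ?_
    have hc : Continuous (fun s : Set.Ici (0:ℝ) => gk d (((s : ℝ) : ℂ) + (t : ℂ) * I) (x - y)) := by
      refine gk_cont d (by fun_prop) continuous_const ?_ (fun _ => hne _)
      intro s
      have h3 : (0:ℝ) ≤ s := Set.mem_Ici.1 s.2
      simpa using h3
    have h1 : Filter.Tendsto (fun n => (⟨e n, Set.mem_Ici.2 (he n).le⟩ : Set.Ici (0:ℝ))) Filter.atTop (nhds ⟨0, Set.mem_Ici.2 le_rfl⟩) := by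
      rw [tendsto_subtype_rng]
      exact hl
    have := (hc.tendsto ⟨0, Set.mem_Ici.2 le_rfl⟩).comp h1
    simpa [Function.comp_def] using this

/-- the regularisation sequence -/
lemma eps_pos (n : ℕ) : (0:ℝ) < 1/((n:ℝ)+1) := by positivity

lemma schrod_le_liminf (d : ℕ) (hd : 1 ≤ d) (r : ℝ≥0∞) {φ : EuclideanSpace ℝ (Fin d) → ℂ}
    (hφ : Integrable φ) {t : ℝ} (ht : t ≠ 0) :
    eLpNorm (schrod d t φ) r volume ≤ Filter.atTop.liminf
      (fun n : ℕ => eLpNorm (fun x => inner ℂ (PH d (eps_pos n) t x) (WD d (eps_pos n) φ)) r volume) := by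
  refine MeasureTheory.Lp.eLpNorm_lim_le_liminf_eLpNorm ?_ _ ?_
  · intro n
    refine Continuous.aestronglyMeasurable ?_
    exact ((PH_cont d (eps_pos n)).comp (by fun_prop : Continuous (fun x => (t, x)))).inner continuous_const
  · filter_upwards with x
    exact WD_tendsto d hd eps_pos tendsto_one_div_add_atTop_nhds_zero_nat hφ ht x

lemma schrod_fatou (d : ℕ) (hd : 1 ≤ d) {r : ℝ≥0∞} {q : ℝ} (hq : 0 < q) {φ : EuclideanSpace ℝ (Fin d) → ℂ}
    (hφ : Integrable φ) {h : ℕ → ℝ → ℝ≥0∞} (hm : ∀ n, Measurable (h n))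
    (hle : ∀ n t, eLpNorm (fun x => inner ℂ (WD d (eps_pos n) φ) (PH d (eps_pos n) t x)) r volume ≤ h n t)
    {K : ℝ≥0∞} (hb : ∀ n, ∫⁻ t, h n t^q ≤ K^q) :
    (∫⁻ t, eLpNorm (schrod d t φ) r volume^q)^(1/q) ≤ K := by
  have hsym : ∀ n t, eLpNorm (fun x => inner ℂ (PH d (eps_pos n) t x) (WD d (eps_pos n) φ)) r volume ≤ h n t := by
    intro n t
    refine le_trans (le_of_eq ?_) (hle n t)
    refine eLpNorm_congr_norm_ae ?_
    filter_upwards with x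
    exact norm_inner_symm _ _
  have h0 : ∀ᵐ t : ℝ, t ≠ 0 := by
    simp [ae_iff]
  have h1 : ∫⁻ t, eLpNorm (schrod d t φ) r volume^q ≤ K^q := by
    calc _ ≤ ∫⁻ t, Filter.atTop.liminf (fun n : ℕ => h n t^q) := by
          refine lintegral_mono_ae ?_
          filter_upwards [h0] with t ht
          have h2 : eLpNorm (schrod d t φ) r volume ≤ Filter.atTop.liminf (fun n : ℕ => h n t) :=
            (schrod_le_liminf d hd r hφ ht).trans (Filter.liminf_le_liminf (Filter.Eventually.of_forall fun n => hsym n t))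
          refine (ENNReal.rpow_le_rpow h2 hq.le).trans (le_of_eq ?_)
          exact (ENNReal.orderIsoRpow q hq).liminf_apply
      _ ≤ Filter.atTop.liminf (fun n : ℕ => ∫⁻ t, h n t^q) := lintegral_liminf_le fun n => (hm n).pow_const q
      _ ≤ Filter.atTop.liminf (fun n : ℕ => K^q) := Filter.liminf_le_liminf (Filter.Eventually.of_forall hb)
      _ = K^q := Filter.liminf_const _
  calc _ ≤ (K^q)^(1/q) := by gcongr
    _ = K := by rw [← ENNReal.rpow_mul, mul_one_div_cancel hq.ne', ENNReal.rpow_one]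

lemma case_qtop (d : ℕ) (hd : 1 ≤ d) {φ : EuclideanSpace ℝ (Fin d) → ℂ} (hφ : Integrable φ) :
    essSup (fun t => eLpNorm (schrod d t φ) 2 volume) volume ≤ eLpNorm φ 2 volume := by
  refine essSup_le_of_ae_le _ ?_
  have h0 : ∀ᵐ t : ℝ, t ≠ 0 := by
    simp [ae_iff]
  filter_upwards [h0] with t ht
  refine (schrod_le_liminf d hd 2 hφ ht).trans ?_
  refine le_trans (Filter.liminf_le_liminf (v := fun _ => eLpNorm φ 2 volume) (Filter.Eventually.of_forall fun n => ?_))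
    (Filter.liminf_const _).le
  refine le_trans ?_ (WD_norm d hd (eps_pos n) hφ)
  rw [eLpNorm_eq_lintegral_rpow_enorm_toReal (by norm_num) (by norm_num)]
  have h := (PH_disp d hd (eps_pos n)).fixed_time (WD d (eps_pos n) φ) t
  simp_rw [enorm_inner_symm (PH d (eps_pos n) t _)]
  simp only [ENNReal.toReal_ofNat, ENNReal.rpow_ofNat]
  calc _ ≤ (‖WD d (eps_pos n) φ‖ₑ^2)^(1/2:ℝ) := by gcongr
    _ = _ := by rw [← ENNReal.rpow_natCast, ← ENNReal.rpow_mul]; norm_num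

lemma case_fin (d : ℕ) (hd : 1 ≤ d) {p b q r : ℝ} {C : ℝ≥0∞} (hq : 2 ≤ q) (hr : 2 ≤ r)
    (hb : 1/b + 1/q = 1) (hp : 1/p + 1/r = 1)
    (hD : ∀ n, DualBound (volume : Measure (EuclideanSpace ℝ (Fin d))) (PH d (eps_pos n)) p b C)
    {φ : EuclideanSpace ℝ (Fin d) → ℂ} (hφ : Integrable φ) :
    (∫⁻ t, eLpNorm (schrod d t φ) (ENNReal.ofReal r) volume^q)^(1/q) ≤ C * eLpNorm φ 2 volume := by
  have hr0 : 0 < r := by linarith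
  refine schrod_fatou d hd (by linarith) hφ
    (h := fun n t => (∫⁻ x, ‖inner ℂ (WD d (eps_pos n) φ) (PH d (eps_pos n) t x)‖ₑ^r)^(1/r)) ?_ ?_ ?_
  · intro n
    refine Measurable.pow_const ?_ _
    have h1 : Measurable (fun z : ℝ × EuclideanSpace ℝ (Fin d) =>
        ‖inner ℂ (WD d (eps_pos n) φ) (PH d (eps_pos n) z.1 z.2)‖ₑ^r) :=
      (Continuous.measurable (continuous_const.inner (PH_cont d (eps_pos n)))).enorm.pow_const r
    exact h1.lintegral_prod_right'
  · intro n t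
    rw [eLpNorm_eq_lintegral_rpow_enorm_toReal (by simpa using hr0) (by norm_num), ENNReal.toReal_ofReal hr0.le]
  · intro n
    have h := dual_full (hD n) (PH_cont d (eps_pos n)).stronglyMeasurable (PH_bdd d (eps_pos n)) hq hr hb hp
      (WD d (eps_pos n) φ)
    simp_rw [← ENNReal.rpow_mul, one_div_mul_eq_div]
    refine h.trans ?_
    rw [mul_comm C]
    gcongr
    exact WD_norm d hd (eps_pos n) hφ

lemma eLpNorm_top_le_dense {d : ℕ} {u : EuclideanSpace ℝ (Fin d) → ℂ} (hu : Continuous u) :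
    eLpNorm u ⊤ volume ≤ ⨆ i, ‖u (TopologicalSpace.denseSeq (EuclideanSpace ℝ (Fin d)) i)‖ₑ := by
  rw [eLpNorm_exponent_top]
  refine essSup_le_of_ae_le _ ?_
  filter_upwards with x
  have hcl : IsClosed {y | ‖u y‖ₑ ≤ ⨆ i, ‖u (TopologicalSpace.denseSeq (EuclideanSpace ℝ (Fin d)) i)‖ₑ} :=
    isClosed_le hu.enorm continuous_const
  have h := (TopologicalSpace.denseRange_denseSeq (EuclideanSpace ℝ (Fin d))).closure_eq
  have h2 : closure (Set.range (TopologicalSpace.denseSeq (EuclideanSpace ℝ (Fin d)))) ⊆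
      {y | ‖u y‖ₑ ≤ ⨆ i, ‖u (TopologicalSpace.denseSeq (EuclideanSpace ℝ (Fin d)) i)‖ₑ} := by
    refine closure_minimal ?_ hcl
    rintro _ ⟨i, rfl⟩
    exact le_iSup (fun i => ‖u (TopologicalSpace.denseSeq (EuclideanSpace ℝ (Fin d)) i)‖ₑ) i
  rw [h] at h2
  exact h2 (Set.mem_univ x)

lemma inner_PH_meas (d : ℕ) {ε : ℝ} (hε : 0 < ε) (w : Lp ℂ 2 (volume : Measure (EuclideanSpace ℝ (Fin d))))
    (x : EuclideanSpace ℝ (Fin d)) : Measurable (fun t : ℝ => ‖inner ℂ w (PH d hε t x)‖ₑ) := by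
  have h1 : Continuous (fun t : ℝ => PH d hε t x) := by
    have h2 : Continuous (fun t : ℝ => (t, x)) := by fun_prop
    have h3 := (PH_cont d hε).comp h2
    simpa only [Function.comp_def] using h3
  exact (Continuous.enorm (continuous_const.inner h1)).measurable

lemma inner_PH_cont (d : ℕ) {ε : ℝ} (hε : 0 < ε) (w : Lp ℂ 2 (volume : Measure (EuclideanSpace ℝ (Fin d))))
    (t : ℝ) : Continuous (fun x : EuclideanSpace ℝ (Fin d) => inner ℂ w (PH d hε t x)) := by
  have h1 : Continuous (fun x => PH d hε t x) := by
    have h2 : Continuous (fun x : EuclideanSpace ℝ (Fin d) => (t, x)) := by fun_prop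
    have h3 := (PH_cont d hε).comp h2
    simpa only [Function.comp_def] using h3
  exact continuous_const.inner h1

lemma case_rtop : ∃ C : ℝ≥0∞, C ≠ ⊤ ∧ ∀ φ : EuclideanSpace ℝ (Fin 1) → ℂ, Integrable φ →
    (∫⁻ t, eLpNorm (schrod 1 t φ) ⊤ volume^(4:ℝ))^(1/4:ℝ) ≤ C * eLpNorm φ 2 volume := by
  obtain ⟨C, hC, h⟩ := Disp.sup (X := EuclideanSpace ℝ (Fin 1)) (ν := volume)
    (H := Lp ℂ 2 (volume : Measure (EuclideanSpace ℝ (Fin 1)))) (σ := 1/2) (by norm_num) (by norm_num)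
  refine ⟨C, hC, fun φ hφ => ?_⟩
  refine schrod_fatou 1 le_rfl (by norm_num) hφ
    (h := fun n t => ⨆ i, ‖inner ℂ (WD 1 (eps_pos n) φ)
      (PH 1 (eps_pos n) t (TopologicalSpace.denseSeq (EuclideanSpace ℝ (Fin 1)) i))‖ₑ) ?_ ?_ ?_
  · intro n
    refine Measurable.iSup fun i => ?_
    exact inner_PH_meas 1 (eps_pos n) _ _
  · intro n t
    refine eLpNorm_top_le_dense ?_
    exact inner_PH_cont 1 (eps_pos n) _ t
  · intro n
    have h1 := h (PH 1 (eps_pos n)) (by simpa using PH_disp 1 le_rfl (eps_pos n)) (WD 1 (eps_pos n) φ)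
      (TopologicalSpace.denseSeq (EuclideanSpace ℝ (Fin 1)))
    rw [show (2:ℝ)/(1/2) = 4 by norm_num] at h1
    refine h1.trans ?_
    rw [mul_comm C]
    gcongr
    exact WD_norm 1 le_rfl (eps_pos n) hφ

/-- **Homogeneous Strichartz estimate.** For `d ≥ 1` and an admissible pair `(q,r)`,
there is `C = C(d,q,r) > 0` such that
`( ∫_ℝ ‖e^{itΔ}φ‖_{L^r}^q dt )^{1/q} ≤ C ‖φ‖_{L²}` for every Schwartz `φ`. -/
theorem strichartz_homogeneous (d : ℕ) (hd : 1 ≤ d) (q r : ℝ≥0∞)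
    (hqr : IsAdmissible d q r) :
    ∃ C > (0 : ℝ), ∀ φ : SchwartzMap (EuclideanSpace ℝ (Fin d)) ℂ,
      mixedLNorm q (fun t : ℝ => eLpNorm (schrod d t ⇑φ) r volume) ≤
        ENNReal.ofReal C * eLpNorm (⇑φ) 2 volume := by
  obtain ⟨hq2, hr2, hadm, hex⟩ := hqr
  have hd0 : (1:ℝ) ≤ d := by exact_mod_cast hd
  suffices H : ∃ C : ℝ≥0∞, C ≠ ⊤ ∧ ∀ φ : EuclideanSpace ℝ (Fin d) → ℂ, Integrable φ →
      mixedLNorm q (fun t : ℝ => eLpNorm (schrod d t φ) r volume) ≤ C * eLpNorm φ 2 volume by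
    obtain ⟨C, hC, h⟩ := H
    refine ⟨C.toReal + 1, by positivity, fun φ => (h φ φ.integrable).trans ?_⟩
    gcongr
    calc C = ENNReal.ofReal C.toReal := (ENNReal.ofReal_toReal hC).symm
      _ ≤ _ := ENNReal.ofReal_le_ofReal (by linarith)
  by_cases hqt : q = ⊤
  · subst hqt
    have hr : r = 2 := by
      have h1 : (d : ℝ≥0∞) / r = (d : ℝ≥0∞) / 2 := by simpa using hadm
      have hrt : r ≠ ⊤ := by
        rintro rfl
        have hh : (d : ℝ≥0∞) / 2 ≠ 0 := by
          simp; omega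
        apply hh
        rw [← h1]; simp
      have h2 := congrArg ENNReal.toReal h1
      have hr0 : (0:ℝ) < r.toReal := ENNReal.toReal_pos (by rintro rfl; simp at hr2) hrt
      simp only [ENNReal.toReal_div, ENNReal.toReal_natCast, ENNReal.toReal_ofNat] at h2
      rw [div_eq_div_iff hr0.ne' (by norm_num)] at h2
      have h3 : r.toReal = 2 := by
        have := mul_left_cancel₀ (by linarith : (d:ℝ) ≠ 0) h2
        exact this.symm
      rw [← ENNReal.ofReal_toReal hrt, h3]; simp
    subst hr
    refine ⟨1, by simp, fun φ hφ => ?_⟩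
    rw [mixedLNorm, if_pos rfl, one_mul]
    exact case_qtop d hd hφ
  have hq0 : (2:ℝ) ≤ q.toReal := by
    have := ENNReal.toReal_mono hqt hq2
    simpa using this
  by_cases hrt : r = ⊤
  · subst hrt
    have h1 : 2 / q = (d : ℝ≥0∞) / 2 := by simpa using hadm
    have h2 := congrArg ENNReal.toReal h1
    simp only [ENNReal.toReal_div, ENNReal.toReal_natCast, ENNReal.toReal_ofNat] at h2
    rw [div_eq_div_iff (by linarith) (by norm_num)] at h2
    have hd2 : d ≤ 2 := by
      have : (d:ℝ) ≤ 2 := by nlinarith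
      exact_mod_cast this
    have hd1 : d = 1 := by
      rcases (by omega : d = 1 ∨ d = 2) with h | h
      · exact h
      · exfalso
        apply hex
        refine ⟨h, ?_, rfl⟩
        rw [h] at h2
        have h3 : q.toReal = 2 := by push_cast at h2; linarith
        rw [← ENNReal.ofReal_toReal hqt, h3]; simp
    subst hd1
    have h4 : q.toReal = 4 := by push_cast at h2; linarith
    obtain ⟨C, hC, h⟩ := case_rtop
    refine ⟨C, hC, fun φ hφ => ?_⟩
    rw [mixedLNorm, if_neg hqt, h4]
    exact h φ hφ
  have hr0 : (2:ℝ) ≤ r.toReal := by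
    have := ENNReal.toReal_mono hrt hr2
    simpa using this
  have hadr : 2 / q.toReal + d / r.toReal = (d:ℝ)/2 := by
    have h2 := congrArg ENNReal.toReal hadm
    rw [ENNReal.toReal_add (ENNReal.div_ne_top (by simp) (by rintro rfl; simp at hq2))
      (ENNReal.div_ne_top (by simp) (by rintro rfl; simp at hr2))] at h2
    simpa only [ENNReal.toReal_div, ENNReal.toReal_natCast, ENNReal.toReal_ofNat] using h2
  have hrr : ENNReal.ofReal r.toReal = r := ENNReal.ofReal_toReal hrt
  have hQp : 0 < q.toReal := by linarith
  have hRp : 0 < r.toReal := by linarith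
  have hdp : (0:ℝ) < d := by linarith
  have hinv : 1 / r.toReal = 1/2 - 2/(d * q.toReal) := by
    have h1 : (d:ℝ) * (1 / r.toReal) = d * (1/2 - 2/(d * q.toReal)) := by
      have h2 : (d:ℝ) * (2/(d * q.toReal)) = 2 / q.toReal := by field_simp
      rw [mul_sub, h2]
      have h3 : (d:ℝ) * (1 / r.toReal) = d / r.toReal := by ring
      linarith
    exact mul_left_cancel₀ hdp.ne' h1
  simp only [mixedLNorm, if_neg hqt]
  by_cases hq : q.toReal = 2
  · have hRi : 0 < 1 / r.toReal := by positivity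
    rw [hq] at hinv
    have hd1 : (1:ℝ)/d < 1/2 := by
      have : 2/((d:ℝ)*2) = 1/d := by field_simp
      linarith
    have hσ : 1 < (d:ℝ)/2 := by
      rw [div_lt_div_iff₀ hdp (by norm_num)] at hd1
      linarith
    refine ⟨CE ((d:ℝ)/2), CE_ne_top hσ, fun φ hφ => ?_⟩
    rw [hq, ← hrr]
    refine case_fin d hd (p := 2*((d:ℝ)/2)/((d:ℝ)/2+1)) (b := 2) (by norm_num) hr0 (by norm_num) ?_ ?_ hφ
    · rw [hinv]
      field_simp
      ring
    · intro n
      exact (PH_disp d hd (eps_pos n)).endpoint hσ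
  · have hq3 : 2 < q.toReal := lt_of_le_of_ne hq0 (Ne.symm hq)
    have hα : (d:ℝ)/2 * (2*(1 - 1/r.toReal) - 1) = 2/q.toReal := by
      rw [hinv]
      field_simp
      ring
    have hQ1 : 2/q.toReal < 1 := by rw [div_lt_one hQp]; exact hq3
    have hθ : 1/2 < 1 - 1/r.toReal := by
      have : 0 < 2/(d * q.toReal) := by positivity
      rw [hinv]; linarith
    have hθ1 : 1 - 1/r.toReal < 1 := by
      have : 0 < 1/r.toReal := by positivity
      linarith
    obtain ⟨C, hC, h⟩ := Disp.nonend (X := EuclideanSpace ℝ (Fin d)) (ν := volume)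
      (H := Lp ℂ 2 (volume : Measure (EuclideanSpace ℝ (Fin d)))) (σ := (d:ℝ)/2) (θ := 1 - 1/r.toReal)
      (by positivity) hθ hθ1 (by rw [hα]; exact hQ1)
    refine ⟨C, hC, fun φ hφ => ?_⟩
    rw [hα] at h
    rw [← hrr]
    refine case_fin d hd (p := 1/(1 - 1/r.toReal)) (b := 2/(2 - 2/q.toReal)) hq0 hr0 ?_ ?_ ?_ hφ
    · have : 2 - 2/q.toReal ≠ 0 := by linarith
      rw [one_div_div]
      ring
    · rw [one_div_one_div]; ring
    · intro n
      exact h _ (PH_disp d hd (eps_pos n))
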